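/- arXiv:2012.11063 — 4 statements merged into one kernel-verified Lean document; each statement's English description precedes it below -/
import Mathlib

section
/- For all complex numbers x, y with |x| < 1/2 and |y| < 1/4, both the series 1 − Σ_{k>n≥1} (Σ_{s=1}^{n} 2^{−s} Σ_{𝐤∈I₀(k,n,s)} T(𝐤)) x^{k−n} y^{n} and the series Σ_{n≥2} (T(n)/(2n))(x^n + y^n − (x+y)^n) converge absolutely, and 1 − Σ_{k>n≥1} (Σ_{s=1}^{n} 2^{−s} Σ_{𝐤∈I₀(k,n,s)} T(𝐤)) x^{k−n} y^{n} = exp( Σ_{n≥2} (T(n)/(2n))(x^n + y^n − (x+y)^n) ). -/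
open Complex Filter Metric Finset

attribute [local instance] Classical.propDecidable

noncomputable section

/-- Condition on the summation variables of the level-two multiple polylogarithm:
`m` is strictly increasing, `m i ≡ i+1 (mod 2)` (so `m 0` is odd, `m 1` even, ...),
and all `m i` are positive. -/
def athCond (n : ℕ) (m : Fin n → ℕ) : Prop :=
  StrictMono m ∧ ∀ i : Fin n, m i % 2 = ((i : ℕ) + 1) % 2 ∧ 0 < m i

/-- The last entry `m n` of the summation sequence (junk value `0` for depth `0`). -/
def lastExp {n : ℕ} (m : Fin n → ℕ) : ℕ :=
  if h : 0 < n then m ⟨n - 1, Nat.sub_lt h Nat.one_pos⟩ else 0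

/-- The level-two multiple polylogarithm
`Ath(𝐤; t) = Σ_{0<m₁<⋯<mₙ, mᵢ ≡ i (2)} t^{mₙ}/(m₁^{k₁}⋯mₙ^{kₙ})`, with `Ath(∅;t) = 1`. -/
def Ath {n : ℕ} (k : Fin n → ℕ) (t : ℂ) : ℂ :=
  ∑' m : Fin n → ℕ,
    if athCond n m then t ^ lastExp m / ∏ i, ((m i : ℂ) ^ k i) else 0

/-- The multiple T-value `T(𝐤) = 2^n Σ_{0<m₁<⋯<mₙ, mᵢ ≡ i (2)} 1/(m₁^{k₁}⋯mₙ^{kₙ})`. -/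
def Tval {n : ℕ} (k : Fin n → ℕ) : ℝ :=
  2 ^ n * ∑' m : Fin n → ℕ,
    if athCond n m then (∏ i, ((m i : ℝ) ^ k i))⁻¹ else 0

/-- `κ` is an index of weight `k`, depth `n` and height `s`. -/
def IdxCond (k n s : ℕ) (κ : Fin n → ℕ) : Prop :=
  (∀ i, 1 ≤ κ i) ∧ (∑ i, κ i) = k ∧ (Finset.univ.filter fun i => 2 ≤ κ i).card = s

/-- `κ` is an admissible index of weight `k`, depth `n` and height `s`. -/
def IdxCond0 (k n s : ℕ) (κ : Fin n → ℕ) : Prop :=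
  IdxCond k n s κ ∧ ∀ h : 0 < n, 2 ≤ κ ⟨n - 1, Nat.sub_lt h Nat.one_pos⟩

/-- `G(k,n,s;t) = 2^n Σ_{𝐤 ∈ I(k,n,s)} Ath(𝐤;t)`. -/
def G (k n s : ℕ) (t : ℂ) : ℂ :=
  2 ^ n * ∑' κ : Fin n → ℕ, if IdxCond k n s κ then Ath κ t else 0

/-- `G₀(k,n,s;t) = 2^n Σ_{𝐤 ∈ I₀(k,n,s)} Ath(𝐤;t)`. -/
def G0 (k n s : ℕ) (t : ℂ) : ℂ :=
  2 ^ n * ∑' κ : Fin n → ℕ, if IdxCond0 k n s κ then Ath κ t else 0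

/-- `Σ_{𝐤 ∈ I₀(k,n,s)} T(𝐤)`. -/
def sumT0 (k n s : ℕ) : ℝ :=
  ∑' κ : Fin n → ℕ, if IdxCond0 k n s κ then Tval κ else 0

/-- One term of the generating function `Φ`. -/
def PhiTerm (x y z : ℂ) (p : ℕ × ℕ × ℕ) (t : ℂ) : ℂ :=
  if 1 ≤ p.1 ∧ 1 ≤ p.2.1 then
    G p.1 p.2.1 p.2.2 t * x ^ (p.1 - p.2.1 - p.2.2) * y ^ (p.2.1 - p.2.2) * z ^ (2 * p.2.2)
  else 0

/-- `Φ(x,y,z;t) = 1 + Σ_{k,n≥1, s≥0} G(k,n,s;t) x^{k−n−s} y^{n−s} z^{2s}`. -/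
def Phi (x y z t : ℂ) : ℂ := 1 + ∑' p : ℕ × ℕ × ℕ, PhiTerm x y z p t

/-- One term of the generating function `Φ₀`. -/
def Phi0Term (x y z : ℂ) (p : ℕ × ℕ × ℕ) (t : ℂ) : ℂ :=
  if 1 ≤ p.1 ∧ 1 ≤ p.2.1 ∧ 1 ≤ p.2.2 then
    G0 p.1 p.2.1 p.2.2 t * x ^ (p.1 - p.2.1 - p.2.2) * y ^ (p.2.1 - p.2.2)
      * z ^ (2 * (p.2.2 - 1))
  else 0

/-- `Φ₀(x,y,z;t) = Σ_{k,n,s≥1} G₀(k,n,s;t) x^{k−n−s} y^{n−s} z^{2(s−1)}`. -/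
def Phi0 (x y z t : ℂ) : ℂ := ∑' p : ℕ × ℕ × ℕ, Phi0Term x y z p t

/-- The shifted factorial `(a)ₙ = a(a+1)⋯(a+n−1)`. -/
def poch (a : ℂ) (n : ℕ) : ℂ := ∏ j ∈ Finset.range n, (a + j)

/-- The Gauss hypergeometric series `F(a,b,c;t)`. -/
def hypF (a b c t : ℂ) : ℂ :=
  ∑' n : ℕ, poch a n * poch b n / ((n.factorial : ℂ) * poch c n) * t ^ n
/-! ### Real recursion -/

def PP (y ξ : ℝ) : ℕ → ℝ
  | 0 => 0
  | 1 => 1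
  | (m + 2) => PP y ξ m + y * (1 / ((m : ℝ) + 1) + 1 / ((m : ℝ) + 1 + ξ)) * PP y ξ (m + 1)

lemma PP_nonneg (y ξ : ℝ) (hy : 0 ≤ y) (hξ : -1/2 < ξ) : ∀ m, 0 ≤ PP y ξ m ∧ 0 ≤ PP y ξ (m+1) := by
  intro m
  induction m with
  | zero => simp [PP]
  | succ m ih =>
    refine ⟨ih.2, ?_⟩
    rw [PP]
    have h1 : (0:ℝ) ≤ m := Nat.cast_nonneg m
    have h2 : (0:ℝ) < (m:ℝ) + 1 + ξ := by linarith
    have := ih.1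
    have := ih.2
    positivity

lemma PP_le (y ξ : ℝ) (hy : 0 ≤ y) (hy4 : y < 1/4) (hξ : -1/2 < ξ) :
    ∀ m : ℕ, PP y ξ m ≤ √(m:ℝ) ∧ PP y ξ (m+1) ≤ √((m:ℝ)+1) := by
  intro m
  induction m with
  | zero => simp [PP]
  | succ m ih =>
    refine ⟨by exact_mod_cast ih.2, ?_⟩
    rw [PP]
    have h1 : (0:ℝ) ≤ m := Nat.cast_nonneg m
    have h2 : (0:ℝ) < (m:ℝ) + 1 + ξ := by linarith
    have hP1 := (PP_nonneg y ξ hy hξ m).2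
    push_cast
    set a := √(m:ℝ) with ha
    set b := √((m:ℝ)+1) with hb
    set c := √((m:ℝ)+1+1) with hc
    have ha0 : 0 ≤ a := Real.sqrt_nonneg _
    have hb0 : 0 < b := Real.sqrt_pos.2 (by linarith)
    have hc0 : 0 < c := Real.sqrt_pos.2 (by linarith)
    have ha2 : a^2 = m := Real.sq_sqrt h1
    have hb2 : b^2 = m+1 := Real.sq_sqrt (by linarith)
    have hc2 : c^2 = m+1+1 := Real.sq_sqrt (by linarith)
    have hw : y * (1 / ((m : ℝ) + 1) + 1 / ((m : ℝ) + 1 + ξ)) ≤ 1 / ((m:ℝ)+1) := by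
      have e1 : 1 / ((m : ℝ) + 1 + ξ) ≤ 2 / ((m:ℝ)+1) := by
        rw [div_le_div_iff₀ h2 (by linarith)]
        linarith
      have e2 : 0 < 1 / ((m : ℝ) + 1) := by positivity
      have e3 : 2 / ((m:ℝ)+1) = 2 * (1 / ((m : ℝ) + 1)) := by ring
      have e4 : 0 < 1 / ((m : ℝ) + 1 + ξ) := by positivity
      nlinarith
    have hb' : b ≠ 0 := hb0.ne'
    have hkey : y * (1 / ((m : ℝ) + 1) + 1 / ((m : ℝ) + 1 + ξ)) * PP y ξ (m + 1) ≤ 1 / b := by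
      calc _ ≤ 1 / ((m:ℝ)+1) * b := by
            apply mul_le_mul hw ih.2 hP1; positivity
        _ = 1 / b := by rw [← hb2]; field_simp
    have hs : a + c ≤ 2 * b := by
      apply abs_le_of_sq_le_sq' _ (by positivity) |>.2
      nlinarith [sq_nonneg (a - c)]
    have hca : (c - a) * (a + c) = 2 := by nlinarith
    have hfin : 1 / b ≤ c - a := by
      rw [div_le_iff₀ hb0]
      have : 0 ≤ c - a := by
        by_contra hcon
        push Not at hcon
        nlinarith
      nlinarith
    linarith [ih.1]

lemma PP_le' {y ξ : ℝ} (hy : 0 ≤ y) (hy4 : y < 1/4) (hξ : -1/2 < ξ) (m : ℕ) :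
    PP y ξ m ≤ √(m:ℝ) := (PP_le y ξ hy hy4 hξ m).1

lemma PP_nn {y ξ : ℝ} (hy : 0 ≤ y) (hξ : -1/2 < ξ) (m : ℕ) :
    0 ≤ PP y ξ m := (PP_nonneg y ξ hy hξ m).1

def hh (y ξ : ℝ) (m : ℕ) : ℝ := y * (1 / (m:ℝ) - 1 / ((m:ℝ) + ξ)) * PP y ξ m

def HH (y ξ : ℝ) : ℝ := 1 + ∑' m, hh y ξ m

lemma hh_zero (y ξ : ℝ) : hh y ξ 0 = 0 := by simp [hh, PP]

lemma hh_summable {y ξ : ℝ} (hy : 0 ≤ y) (hy4 : y < 1/4) (hξ : -1/2 < ξ) :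
    Summable (hh y ξ) := by
  have hs : Summable (fun m : ℕ => (2 * y * |ξ|) * (1 / (m:ℝ) ^ (3/2:ℝ))) :=
    (Real.summable_one_div_nat_rpow.2 (by norm_num)).mul_left _
  refine Summable.of_norm_bounded hs ?_
  intro m
  rcases Nat.eq_zero_or_pos m with rfl | hm
  · simp [hh_zero]
  have hm1 : (1:ℝ) ≤ m := by exact_mod_cast hm
  have h2 : (0:ℝ) < (m:ℝ) + ξ := by linarith
  have e : 1 / (m:ℝ) - 1 / ((m:ℝ) + ξ) = ξ / (m * (m+ξ)) := by
    field_simp; ring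
  rw [hh, e, Real.norm_eq_abs, abs_mul, abs_mul, abs_of_nonneg hy,
    abs_of_nonneg (PP_nn hy hξ m), abs_div, abs_of_pos (by positivity : (0:ℝ) < m * (m+ξ))]
  have e2 : (m:ℝ)^(3/2:ℝ) = m * √m := by
    rw [Real.sqrt_eq_rpow, show (3/2:ℝ) = 1 + 1/2 by norm_num, Real.rpow_add (by linarith), Real.rpow_one]
  have hsq : √(m:ℝ) * √m = m := Real.mul_self_sqrt (by linarith)
  have hsp : 0 < √(m:ℝ) := Real.sqrt_pos.2 (by linarith)
  calc y * (|ξ| / (m * (m+ξ))) * PP y ξ m ≤ y * (|ξ| / (m * (m/2))) * √m := by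
        gcongr
        · exact PP_nn hy hξ m
        · linarith
        · exact PP_le' hy hy4 hξ m
    _ = _ := by
        rw [e2]
        have : (m:ℝ) ≠ 0 := by linarith
        have : √(m:ℝ) ≠ 0 := hsp.ne'
        field_simp
        rw [Real.sq_sqrt (by linarith)]

lemma PP_div_tendsto {y ξ : ℝ} (hy : 0 ≤ y) (hy4 : y < 1/4) (hξ : -1/2 < ξ) :
    Tendsto (fun m : ℕ => PP y ξ m / (m + ξ)) atTop (nhds 0) := by
  have h0 : Tendsto (fun m : ℕ => 2 * (√(m:ℝ))⁻¹) atTop (nhds (2 * 0)) :=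
    ((Real.tendsto_sqrt_atTop.comp tendsto_natCast_atTop_atTop).inv_tendsto_atTop).const_mul 2
  rw [mul_zero] at h0
  refine squeeze_zero' ?_ ?_ h0
  · filter_upwards [eventually_ge_atTop 1] with m hm
    have hm1 : (1:ℝ) ≤ m := by exact_mod_cast hm
    exact div_nonneg (PP_nn hy hξ m) (by linarith)
  · filter_upwards [eventually_ge_atTop 1] with m hm
    have hm1 : (1:ℝ) ≤ m := by exact_mod_cast hm
    have hsq : √(m:ℝ) * √m = m := Real.mul_self_sqrt (by linarith)
    have hsp : 0 < √(m:ℝ) := Real.sqrt_pos.2 (by linarith)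
    rw [div_le_iff₀ (by linarith)]
    refine (PP_le' hy hy4 hξ m).trans ?_
    rw [mul_assoc, inv_mul_eq_div, ← mul_div_assoc, le_div_iff₀ hsp]
    linarith

lemma PP_shift {y ξ : ℝ} (hξ : -1/2 < ξ) : ∀ m : ℕ,
    PP y (ξ+2) m * ((1+ξ)^2 - y^2) = (1+ξ)^2 *
      (PP y ξ m - y * m * PP y ξ (m+1) / ((m+1+ξ)*(1+ξ))) ∧
    PP y (ξ+2) (m+1) * ((1+ξ)^2 - y^2) = (1+ξ)^2 *
      (PP y ξ (m+1) - y * (m+1) * PP y ξ (m+2) / ((m+2+ξ)*(1+ξ))) := by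
  intro m
  have h0 : (1 + ξ) ≠ 0 := by linarith
  induction m with
  | zero =>
    have h2 : (2 + ξ) ≠ 0 := by linarith
    simp [PP]
    field_simp
    ring
  | succ m ih =>
    have h1 : (0:ℝ) ≤ m := Nat.cast_nonneg m
    have a1 : (m:ℝ) + 1 ≠ 0 := by linarith
    have a2 : (m:ℝ) + 2 ≠ 0 := by linarith
    have a4 : (m:ℝ) + 1 + ξ ≠ 0 := by linarith
    have a5 : (m:ℝ) + 2 + ξ ≠ 0 := by linarith
    have a6 : (m:ℝ) + 3 + ξ ≠ 0 := by linarith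
    refine ⟨?_, ?_⟩
    · have := ih.2
      push_cast
      rw [this, show (m:ℝ)+1+1+ξ = m+2+ξ by ring]
    · have e1 : PP y (ξ+2) (m+1+1) = PP y (ξ+2) m + y * (1 / ((m : ℝ) + 1) + 1 / ((m : ℝ) + 1 + (ξ+2))) * PP y (ξ+2) (m + 1) := by rw [PP]
      have e2 : PP y ξ (m+1+2) = PP y ξ (m+1) + y * (1 / ((m : ℝ) + 2) + 1 / ((m : ℝ) + 2 + ξ)) * PP y ξ (m + 2) := by
        rw [PP]; push_cast; ring_nf
      have e3 : PP y ξ (m+1+1) = PP y ξ m + y * (1 / ((m : ℝ) + 1) + 1 / ((m : ℝ) + 1 + ξ)) * PP y ξ (m + 1) := by rw [PP]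
      have e3' : PP y ξ (m+2) = PP y ξ m + y * (1 / ((m : ℝ) + 1) + 1 / ((m : ℝ) + 1 + ξ)) * PP y ξ (m + 1) := by rw [PP]
      rw [e1, add_mul, mul_assoc _ (PP y (ξ+2) (m+1)), ih.1, ih.2, e2, e3]
      push_cast
      rw [show (m:ℝ)+1+2+ξ = m+3+ξ by ring, show (m:ℝ)+1+(ξ+2) = m+3+ξ by ring, show (m:ℝ)+1+1 = m+2 by ring]
      field_simp
      ring

lemma hh_shift {y ξ : ℝ} (hy : 0 ≤ y) (hy4 : y < 1/4) (hξ : -1/2 < ξ) (m : ℕ) :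
    hh y (ξ+2) (m+1) = (1+ξ)^2 / ((1+ξ)^2 - y^2) *
      (hh y ξ (m+1) + y / (1+ξ) * hh y ξ (m+2)
        + y * (PP y ξ (m+1) / ((m+1:ℕ) + ξ) - PP y ξ (m+3) / ((m+3:ℕ) + ξ))) := by
  have h1 : (0:ℝ) ≤ m := Nat.cast_nonneg m
  have h0 : (1 + ξ) ≠ 0 := by linarith
  have hb : (1+ξ)^2 - y^2 ≠ 0 := by
    have : 0 < (1+ξ)^2 - y^2 := by nlinarith
    exact this.ne'
  have a1 : (m:ℝ) + 1 ≠ 0 := by linarith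
  have a2 : (m:ℝ) + 2 ≠ 0 := by linarith
  have a4 : (m:ℝ) + 1 + ξ ≠ 0 := by linarith
  have a5 : (m:ℝ) + 2 + ξ ≠ 0 := by linarith
  have a6 : (m:ℝ) + 3 + ξ ≠ 0 := by linarith
  have e := (PP_shift (y := y) hξ m).2
  have e' : PP y (ξ+2) (m+1) = (1+ξ)^2 *
      (PP y ξ (m+1) - y * (m+1) * PP y ξ (m+2) / ((m+2+ξ)*(1+ξ))) / ((1+ξ)^2 - y^2) := by
    rw [← e]; field_simp
  have e2 : PP y ξ (m+3) = PP y ξ (m+1) + y * (1 / ((m : ℝ) + 2) + 1 / ((m : ℝ) + 2 + ξ)) * PP y ξ (m + 2) := by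
    rw [PP]; push_cast; ring_nf
  rw [hh, hh, hh, e', e2]
  push_cast
  rw [show (m:ℝ)+1+(ξ+2) = m+3+ξ by ring]
  field_simp
  ring

lemma HH_shift {y ξ : ℝ} (hy : 0 ≤ y) (hy4 : y < 1/4) (hξ : -1/2 < ξ) :
    HH y (ξ+2) = (1+ξ) / (1+ξ-y) * HH y ξ := by
  have h0 : (1 + ξ) ≠ 0 := by linarith
  have h2 : (2 + ξ) ≠ 0 := by linarith
  have hb1 : (1+ξ) - y ≠ 0 := by
    have : 0 < (1+ξ) - y := by linarith
    exact this.ne'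
  have hb2 : (1+ξ) + y ≠ 0 := by
    have : 0 < (1+ξ) + y := by linarith
    exact this.ne'
  have hbe : (1+ξ)^2 - y^2 = (1+ξ-y)*(1+ξ+y) := by ring
  set β := (1+ξ)^2 / ((1+ξ)^2 - y^2) with hβ
  let a : ℕ → ℝ := fun m => PP y ξ m / ((m:ℕ) + ξ)
  have ha : Tendsto a atTop (nhds 0) := PP_div_tendsto hy hy4 hξ
  have hfin : ∀ N : ℕ, ∑ m ∈ Finset.range N, hh y (ξ+2) (m+1) =
      β * (∑ m ∈ Finset.range N, hh y ξ (m+1) + y/(1+ξ) * ∑ m ∈ Finset.range N, hh y ξ (m+2)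
        + y * (a 1 + a 2 - a (N+1) - a (N+2))) := by
    intro N
    induction N with
    | zero => simp
    | succ N ih =>
      rw [Finset.sum_range_succ, ih, hh_shift hy hy4 hξ, Finset.sum_range_succ, Finset.sum_range_succ]
      simp only [a, ← hβ]
      push_cast
      ring
  have s1 := hh_summable hy hy4 hξ
  have s2 := hh_summable (ξ := ξ+2) hy hy4 (by linarith)
  have t0 : HasSum (fun m => hh y (ξ+2) (m+1)) (∑' m, hh y (ξ+2) m) := by
    have := (hasSum_nat_add_iff' 1).2 s2.hasSum
    simpa [hh_zero] using this
  have t1 : HasSum (fun m => hh y ξ (m+1)) (∑' m, hh y ξ m) := by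
    have := (hasSum_nat_add_iff' 1).2 s1.hasSum
    simpa [hh_zero] using this
  have t2 : HasSum (fun m => hh y ξ (m+2)) (∑' m, hh y ξ m - hh y ξ 1) := by
    have := (hasSum_nat_add_iff' 2).2 s1.hasSum
    simpa [hh_zero, Finset.sum_range_succ] using this
  have l1 := t0.tendsto_sum_nat
  have l2 : Tendsto (fun N : ℕ => β * (∑ m ∈ Finset.range N, hh y ξ (m+1) + y/(1+ξ) * ∑ m ∈ Finset.range N, hh y ξ (m+2)
        + y * (a 1 + a 2 - a (N+1) - a (N+2)))) atTop (nhds (β * (∑' m, hh y ξ m + y/(1+ξ) * (∑' m, hh y ξ m - hh y ξ 1) + y * (a 1 + a 2 - 0 - 0)))) := by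
    apply Tendsto.const_mul
    apply Tendsto.add
    · exact t1.tendsto_sum_nat.add (t2.tendsto_sum_nat.const_mul _)
    · apply Tendsto.const_mul
      exact (tendsto_const_nhds.sub ((tendsto_add_atTop_iff_nat 1).2 ha)).sub ((tendsto_add_atTop_iff_nat 2).2 ha)
  have hEq := tendsto_nhds_unique l1 ((funext hfin : _ = _) ▸ l2)
  rw [HH, HH, hEq]
  have c1 : a 1 = 1 / (1+ξ) := by simp [a, PP]
  have c2 : a 2 = y / (1+ξ) := by
    simp only [a, PP]
    push_cast
    simp only [zero_add]
    field_simp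
    ring
  have c3 : hh y ξ 1 = y * ξ / (1+ξ) := by
    simp only [hh, PP]
    push_cast
    field_simp
    ring
  rw [c1, c2, c3, hβ, hbe]
  generalize ∑' m, hh y ξ m = S
  field_simp
  ring

lemma HH_zero (y : ℝ) : HH y 0 = 1 := by
  simp [HH, hh]

lemma HH_prod {y ξ : ℝ} (hy : 0 ≤ y) (hy4 : y < 1/4) (hξ : -1/2 < ξ) (J : ℕ) :
    HH y (ξ+2*J) = (∏ j ∈ Finset.range J, (1+ξ+2*j) / (1+ξ+2*j-y)) * HH y ξ := by
  induction J with
  | zero => simp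
  | succ J ih =>
    have h1 : (0:ℝ) ≤ J := Nat.cast_nonneg J
    rw [Finset.prod_range_succ, show ξ + 2*((J+1:ℕ):ℝ) = (ξ+2*J)+2 by push_cast; ring,
      HH_shift hy hy4 (by linarith), ih]
    ring_nf

lemma PP_anti {y ξ ξ' : ℝ} (hy : 0 ≤ y) (hξ : 0 < ξ) (h : ξ ≤ ξ') : ∀ m : ℕ,
    PP y ξ' m ≤ PP y ξ m ∧ PP y ξ' (m+1) ≤ PP y ξ (m+1) := by
  intro m
  induction m with
  | zero => simp [PP]
  | succ m ih =>
    refine ⟨ih.2, ?_⟩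
    rw [PP, PP]
    have := PP_nn hy (by linarith : -1/2 < ξ') (m+1)
    gcongr
    · exact ih.1
    · exact ih.2

lemma HH_le {y ξ ξ' : ℝ} (hy : 0 ≤ y) (hy4 : y < 1/4) (hξ : 0 < ξ) (h : ξ ≤ ξ') :
    HH y ξ' ≤ (ξ'/ξ) * HH y ξ := by
  have s1 := hh_summable (ξ := ξ) hy hy4 (by linarith)
  have s2 := hh_summable (ξ := ξ') hy hy4 (by linarith)
  have hr : 1 ≤ ξ'/ξ := by rwa [le_div_iff₀ hξ, one_mul]
  rw [HH, HH, mul_add, ← tsum_mul_left]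
  refine add_le_add (by linarith) (s2.tsum_le_tsum ?_ (s1.mul_left _))
  intro m
  rcases Nat.eq_zero_or_pos m with rfl | hm
  · simp [hh_zero]
  have hm1 : (1:ℝ) ≤ m := by exact_mod_cast hm
  have e : ∀ η : ℝ, 0 < η → 1 / (m:ℝ) - 1 / ((m:ℝ) + η) = η / (m * (m+η)) := by
    intro η hη
    have : (m:ℝ) + η ≠ 0 := by linarith
    field_simp; ring
  have hξ' : 0 < ξ' := by linarith
  rw [hh, hh, e _ hξ, e _ hξ']
  have := PP_nn hy (by linarith : -1/2 < ξ') m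
  calc y * (ξ' / (m * (m+ξ'))) * PP y ξ' m ≤ y * (ξ' / (m * (m+ξ))) * PP y ξ m := by
        gcongr
        exact (PP_anti hy hξ h m).1
    _ = _ := by field_simp

lemma HH_ge_one {y ξ : ℝ} (hy : 0 ≤ y) (hξ : 0 ≤ ξ) : 1 ≤ HH y ξ := by
  rw [HH]
  have : 0 ≤ ∑' m, hh y ξ m := by
    apply tsum_nonneg
    intro m
    rcases Nat.eq_zero_or_pos m with rfl | hm
    · simp [hh_zero]
    have hm1 : (1:ℝ) ≤ m := by exact_mod_cast hm
    have := PP_nn hy (by linarith : -1/2 < ξ) m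
    have h2 : 1 / ((m:ℝ) + ξ) ≤ 1 / m := by gcongr; linarith
    rw [hh]
    have : 0 ≤ 1 / (m:ℝ) - 1 / ((m:ℝ) + ξ) := by linarith
    positivity
  linarith

lemma HH_ratio {y ξ : ℝ} (hy : 0 ≤ y) (hy4 : y < 1/4) (hξ : -1/2 < ξ) (hξ0 : ξ ≤ 0) :
    Tendsto (fun J : ℕ => HH y (ξ+2*J) / HH y (2*J)) atTop (nhds 1) := by
  have hJ : Tendsto (fun J : ℕ => (2*(J:ℝ))) atTop atTop :=
    tendsto_natCast_atTop_atTop.const_mul_atTop (by norm_num)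
  have l1 : Tendsto (fun J : ℕ => (ξ + 2*(J:ℝ)) / (2*J)) atTop (nhds 1) := by
    have : Tendsto (fun J : ℕ => ξ / (2*(J:ℝ)) + 1) atTop (nhds (0+1)) :=
      (hJ.const_div_atTop ξ).add_const 1
    rw [zero_add] at this
    refine this.congr' ?_
    filter_upwards [eventually_ge_atTop 1] with m hm
    have hm1 : (1:ℝ) ≤ m := by exact_mod_cast hm
    have : (m:ℝ) ≠ 0 := by linarith
    field_simp
  have l2 : Tendsto (fun J : ℕ => (ξ + 2*(J:ℝ)) / (2*J-2)) atTop (nhds 1) := by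
    have : Tendsto (fun J : ℕ => (ξ+2) / (2*(J:ℝ)-2) + 1) atTop (nhds (0+1)) :=
      ((tendsto_atTop_add_const_right _ (-2) hJ).const_div_atTop (ξ+2)).add_const 1
    rw [zero_add] at this
    refine this.congr' ?_
    filter_upwards [eventually_ge_atTop 2] with m hm
    have hm1 : (2:ℝ) ≤ m := by exact_mod_cast hm
    have : 2*(m:ℝ)-2 ≠ 0 := by
      have : 0 < 2*(m:ℝ)-2 := by linarith
      exact this.ne'
    rw [div_add_one this]
    ring_nf
  refine tendsto_of_tendsto_of_tendsto_of_le_of_le' l1 l2 ?_ ?_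
  · filter_upwards [eventually_ge_atTop 2] with m hm
    have hm1 : (2:ℝ) ≤ m := by exact_mod_cast hm
    have h1 := HH_ge_one (ξ := 2*m) hy (by linarith)
    have h3 := HH_le (ξ := ξ+2*m) (ξ' := 2*m) hy hy4 (by linarith) (by linarith)
    rw [le_div_iff₀ (by linarith), div_mul_eq_mul_div, div_le_iff₀ (by linarith)]
    rw [div_mul_eq_mul_div, le_div_iff₀ (by linarith)] at h3
    linarith
  · filter_upwards [eventually_ge_atTop 2] with m hm
    have hm1 : (2:ℝ) ≤ m := by exact_mod_cast hm
    have h1 := HH_ge_one (ξ := 2*m) hy (by linarith)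
    have h1' := HH_ge_one (ξ := 2*m-2) hy (by linarith)
    have h3 := HH_le (ξ := 2*m-2) (ξ' := ξ+2*m) hy hy4 (by linarith) (by linarith)
    have h4 := HH_shift (ξ := 2*m-2) hy hy4 (by linarith)
    rw [show (2*(m:ℝ)-2+2) = 2*m by ring] at h4
    have h5 : HH y (2*m-2) ≤ HH y (2*m) := by
      rw [h4]
      apply le_mul_of_one_le_left (by linarith)
      rw [le_div_iff₀ (by linarith)]
      linarith
    rw [div_le_iff₀ (by linarith)]
    refine h3.trans ?_
    apply mul_le_mul_of_nonneg_left h5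
    apply div_nonneg <;> linarith

lemma HH_limit {y x : ℝ} (hy : 0 ≤ y) (hy4 : y < 1/4) (hx0 : 0 ≤ x) (hx : x < 1/2) :
    Tendsto (fun J : ℕ => ∏ j ∈ Finset.range J,
      ((1 - (x+y)/(2*j+1)) / ((1 - x/(2*j+1)) * (1 - y/(2*j+1))))) atTop (nhds (HH y (-x))) := by
  have l := (HH_ratio (ξ := -x) hy hy4 (by linarith) (by linarith)).inv₀ one_ne_zero
  have l2 := l.mul_const (HH y (-x))
  rw [inv_one, one_mul] at l2
  refine l2.congr ?_
  intro J
  have e1 := HH_prod (ξ := 0) hy hy4 (by norm_num) J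
  have e2 := HH_prod (ξ := -x) hy hy4 (by linarith) J
  rw [zero_add, HH_zero, mul_one] at e1
  have hne : HH y (-x+2*J) ≠ 0 → HH y (-x) ≠ 0 := by
    intro h h'
    rw [h', mul_zero] at e2
    exact h e2
  have hH : HH y (-x) ≠ 0 := by
    have e3 := HH_prod (ξ := -x) hy hy4 (by linarith) 1
    intro h'
    rw [h', mul_zero] at e3
    have := HH_ge_one (ξ := -x+2*(1:ℕ)) hy (by push_cast; linarith)
    linarith
  rw [e1, e2, inv_div, ← div_div, div_mul_cancel₀ _ hH, ← Finset.prod_div_distrib]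
  apply Finset.prod_congr rfl
  intro j _
  have h1 : (0:ℝ) ≤ j := Nat.cast_nonneg j
  have b1 : (2*(j:ℝ)+1) ≠ 0 := by linarith
  have b2 : 1 + -x + 2*(j:ℝ) ≠ 0 := by
    have : 0 < 1 + -x + 2*(j:ℝ) := by linarith
    exact this.ne'
  have b3 : 1 + 0 + 2*(j:ℝ) - y ≠ 0 := by
    have : 0 < 1 + 0 + 2*(j:ℝ) - y := by linarith
    exact this.ne'
  have b4 : 1 + 0 + 2*(j:ℝ) ≠ 0 := by linarith
  have b5 : 1 + -x + 2*(j:ℝ) - y ≠ 0 := by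
    have : 0 < 1 + -x + 2*(j:ℝ) - y := by linarith
    exact this.ne'
  rw [show 1 - (x+y)/(2*(j:ℝ)+1) = (1 + -x + 2*(j:ℝ) - y)/(2*j+1) by field_simp; ring,
    show 1 - x/(2*(j:ℝ)+1) = (1 + -x + 2*(j:ℝ))/(2*j+1) by field_simp; ring,
    show 1 - y/(2*(j:ℝ)+1) = (1 + 0 + 2*(j:ℝ) - y)/(2*j+1) by field_simp; ring,
    ]
  have b6 : (1 + 0 + 2*(j:ℝ)) = 2*j+1 := by ring
  field_simp
  ring
/-! ### The exponential side -/

def lam (n : ℕ) : ℝ := ∑' j : ℕ, (((2 * j + 1 : ℕ) : ℝ) ^ n)⁻¹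

lemma lam_nonneg (n : ℕ) : 0 ≤ lam n := tsum_nonneg fun j => by positivity

lemma Tval_single (n : ℕ) : Tval ![n] = 2 * lam n := by
  unfold Tval lam
  rw [pow_one]
  congr 1
  rw [← (Equiv.funUnique (Fin 1) ℕ).symm.tsum_eq]
  have hinj : Function.Injective (fun j : ℕ => 2 * j + 1) := fun a b h => by
    simp only at h; omega
  have hc : ∀ m : ℕ, athCond 1 ((Equiv.funUnique (Fin 1) ℕ).symm m) ↔ m % 2 = 1 := by
    intro m
    unfold athCond
    constructor
    · intro h
      simpa using (h.2 0).1
    · intro h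
      refine ⟨Subsingleton.strictMono _, ?_⟩
      intro i
      have : i = 0 := Subsingleton.elim _ _
      subst this
      simp [Equiv.funUnique]
      omega
  have hfun : (fun m : ℕ => if athCond 1 ((Equiv.funUnique (Fin 1) ℕ).symm m) then
      (∏ i, ((((Equiv.funUnique (Fin 1) ℕ).symm m) i : ℕ) : ℝ) ^ (![n] : Fin 1 → ℕ) i)⁻¹ else 0)
      = fun m : ℕ => if m % 2 = 1 then ((m : ℝ) ^ n)⁻¹ else 0 := by
    funext m
    simp only [hc]
    simp
  rw [hfun, ← hinj.tsum_eq]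
  · apply tsum_congr
    intro j
    rw [if_pos (by omega)]
  · intro m hm
    rw [Function.mem_support] at hm
    have : m % 2 = 1 := by
      by_contra h
      simp [h] at hm
    exact ⟨m / 2, by simp only; omega⟩

def ff (z : ℝ) (p : ℕ × ℕ) : ℝ :=
  if 2 ≤ p.1 then z ^ p.1 / p.1 * (((2 * p.2 + 1 : ℕ) : ℝ) ^ p.1)⁻¹ else 0

lemma ff_summable {z : ℝ} (hz : 0 ≤ z) (hz1 : z < 1) : Summable (ff z) := by
  have h1 : Summable (fun n : ℕ => z ^ n) := summable_geometric_of_lt_one hz hz1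
  have h2 : Summable (fun j : ℕ => (((2 * j + 1 : ℕ) : ℝ) ^ 2)⁻¹) := by
    have : Summable (fun m : ℕ => ((m : ℝ) ^ 2)⁻¹) := Real.summable_nat_pow_inv.2 (by norm_num)
    exact this.comp_injective (i := fun j : ℕ => 2 * j + 1) (fun a b h => by simp only at h; omega)
  have h3 := h1.mul_of_nonneg h2 (fun n => by positivity) (fun j => by positivity)
  refine Summable.of_nonneg_of_le ?_ ?_ h3
  · intro p
    unfold ff
    split_ifs <;> positivity
  · rintro ⟨n, j⟩
    unfold ff
    simp only
    split_ifs with h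
    · have hn : (1:ℝ) ≤ n := by exact_mod_cast (by omega : 1 ≤ n)
      have hj : (1:ℝ) ≤ ((2 * j + 1 : ℕ) : ℝ) := by exact_mod_cast (by omega : 1 ≤ 2*j+1)
      gcongr
      exact div_le_self (by positivity) hn
    · positivity

lemma ff_fst (z : ℝ) (n : ℕ) : ∑' j, ff z (n, j) = if 2 ≤ n then lam n * z ^ n / n else 0 := by
  unfold ff lam
  split_ifs
  · simp only
    rw [tsum_mul_left]; ring
  · simp

def gl (z : ℝ) (j : ℕ) : ℝ := -Real.log (1 - z / (2 * j + 1)) - z / (2 * j + 1)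

lemma ff_snd {z : ℝ} (hz : 0 ≤ z) (hz1 : z < 1) (j : ℕ) : ∑' n, ff z (n, j) = gl z j := by
  have hj : (1:ℝ) ≤ 2 * j + 1 := by have : (0:ℝ) ≤ j := Nat.cast_nonneg j; linarith
  have hu : |z / (2 * j + 1)| < 1 := by
    rw [abs_of_nonneg (by positivity), div_lt_one (by linarith)]
    linarith
  have h := Real.hasSum_pow_div_log_of_abs_lt_one hu
  have h1 := (hasSum_nat_add_iff' 1).2 h
  have h2 : HasSum (fun n => ff z (n + 2, j)) (gl z j) := by
    have e1 : (fun n => ff z (n + 2, j)) = fun n : ℕ => (z / (2 * j + 1)) ^ (n + 1 + 1) / (((n + 1 : ℕ) : ℝ) + 1) := by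
      funext n
      unfold ff
      simp only
      rw [if_pos (by omega), div_pow]
      push_cast
      ring
    have e2 : gl z j = -Real.log (1 - z / (2 * j + 1)) - ∑ i ∈ Finset.range 1, (z / (2 * j + 1)) ^ (i + 1) / ((i:ℝ) + 1) := by
      simp [gl]
    rw [e1, e2]
    exact h1
  have h3 := (hasSum_nat_add_iff (f := fun n => ff z (n, j)) 2).1 h2
  rw [h3.tsum_eq]
  simp [Finset.sum_range_succ, ff]

def bb (z : ℝ) (n : ℕ) : ℝ := if 2 ≤ n then lam n * z ^ n / n else 0

lemma bb_summable {z : ℝ} (hz : 0 ≤ z) (hz1 : z < 1) : Summable (bb z) := by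
  have := (ff_summable hz hz1).prod
  simp only [ff_fst] at this
  exact this

lemma gl_hasSum {z : ℝ} (hz : 0 ≤ z) (hz1 : z < 1) : HasSum (gl z) (∑' n, bb z n) := by
  have hs := ff_summable hz hz1
  have h1 : ∑' n, bb z n = ∑' p, ff z p := by
    rw [hs.tsum_prod]
    apply tsum_congr
    intro n
    rw [ff_fst, bb]
  have h2 : HasSum (fun j => ∑' n, ff z (n, j)) (∑' p, ff z p) := by
    have hs' := hs.prod_symm
    have := hs'.hasSum.prod_fiberwise (fun j => (hs'.prod_factor j).hasSum)
    have e := (Equiv.prodComm ℕ ℕ).tsum_eq (ff z)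
    rw [← e]
    exact this
  rw [h1]
  simpa only [ff_snd hz hz1] using h2

lemma real_rhs {x y : ℝ} (hy : 0 ≤ y) (hy4 : y < 1/4) (hx0 : 0 ≤ x) (hx : x < 1/2) :
    Real.exp (∑' n, (bb x n + bb y n - bb (x + y) n)) = HH y (-x) := by
  have sx := bb_summable hx0 (by linarith)
  have sy := bb_summable hy (by linarith)
  have sxy := bb_summable (z := x + y) (by linarith) (by linarith)
  have h := ((gl_hasSum hx0 (by linarith)).add (gl_hasSum hy (by linarith))).sub
    (gl_hasSum (z := x + y) (by linarith) (by linarith))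
  rw [← sx.tsum_add sy, ← (sx.add sy).tsum_sub sxy] at h
  have l1 := (Real.continuous_exp.tendsto _).comp h.tendsto_sum_nat
  refine tendsto_nhds_unique l1 ((HH_limit hy hy4 hx0 hx).congr ?_)
  intro J
  simp only [Function.comp]
  rw [Real.exp_sum]
  apply Finset.prod_congr rfl
  intro j _
  have hj : (1:ℝ) ≤ 2 * j + 1 := by have : (0:ℝ) ≤ j := Nat.cast_nonneg j; linarith
  have key : ∀ z : ℝ, z < 1 → 0 ≤ z → 0 < 1 - z / (2 * j + 1) := by
    intro z hz hz0
    have : z / (2 * j + 1) < 1 := by rw [div_lt_one (by linarith)]; linarith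
    linarith
  have k1 := key x (by linarith) hx0
  have k2 := key y (by linarith) hy
  have k3 := key (x+y) (by linarith) (by linarith)
  unfold gl
  rw [show -Real.log (1 - x / (2 * j + 1)) - x / (2 * j + 1)
      + (-Real.log (1 - y / (2 * j + 1)) - y / (2 * j + 1))
      - (-Real.log (1 - (x + y) / (2 * j + 1)) - (x + y) / (2 * j + 1))
      = Real.log (1 - (x + y) / (2 * j + 1)) - (Real.log (1 - x / (2 * j + 1)) + Real.log (1 - y / (2 * j + 1))) by ring,
    Real.exp_sub, Real.exp_add, Real.exp_log k1, Real.exp_log k2, Real.exp_log k3]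

/-! ### Combinatorics in ENNReal -/

def cR (x y : ℝ) (κ m : ℕ) : ℝ :=
  if κ = 0 then 0 else 2 * (if 2 ≤ κ then 1 / 2 else 1) * x ^ (κ - 1) * y * ((m : ℝ) ^ κ)⁻¹

lemma cR_nonneg {x y : ℝ} (hx : 0 ≤ x) (hy : 0 ≤ y) (κ m : ℕ) : 0 ≤ cR x y κ m := by
  unfold cR
  split_ifs <;> positivity

def cE (x y : ℝ) (κ m : ℕ) : ENNReal := ENNReal.ofReal (cR x y κ m)

def wE (x y : ℝ) (m : ℕ) : ENNReal := ∑' κ, cE x y κ m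

def vE (x y : ℝ) (m : ℕ) : ENNReal := ∑' κ, if 2 ≤ κ then cE x y κ m else 0

lemma tsum_succ_ennreal (f : ℕ → ENNReal) : ∑' n, f n = f 0 + ∑' n, f (n+1) :=
  tsum_eq_zero_add' ENNReal.summable

lemma vE_eq {x y : ℝ} (hx : 0 ≤ x) (hx2 : x < 1/2) (hy : 0 ≤ y) (m : ℕ) (hm : 0 < m) :
    vE x y m = ENNReal.ofReal (y * (1 / ((m:ℝ) - x) - 1 / m)) := by
  have hm1 : (1:ℝ) ≤ m := by exact_mod_cast hm
  have hg : HasSum (fun n : ℕ => (x / m) ^ n) (1 - x / m)⁻¹ :=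
    hasSum_geometric_of_lt_one (by positivity) (by rw [div_lt_one (by linarith)]; linarith)
  have h1 := hg.mul_left (y * x / m ^ 2)
  have h2 : HasSum (fun κ : ℕ => cR x y (κ + 2) m) (y * (1 / ((m:ℝ) - x) - 1 / m)) := by
    have e1 : (fun κ : ℕ => cR x y (κ + 2) m) = fun n : ℕ => y * x / m ^ 2 * (x / m) ^ n := by
      funext κ
      unfold cR
      rw [if_neg (by omega), if_pos (by omega), show κ + 2 - 1 = κ + 1 by omega]
      have : (m:ℝ) ≠ 0 := by linarith
      rw [div_pow]
      field_simp
      ring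
    have e2 : y * (1 / ((m:ℝ) - x) - 1 / m) = y * x / m ^ 2 * (1 - x / m)⁻¹ := by
      have : (m:ℝ) ≠ 0 := by linarith
      have : (m:ℝ) - x ≠ 0 := by
        have : 0 < (m:ℝ) - x := by linarith
        exact this.ne'
      have : 1 - x / m = (m - x) / m := by field_simp
      rw [this]
      field_simp
      ring
    rw [e1, e2]
    exact h1
  rw [vE, ← h2.tsum_eq, ENNReal.ofReal_tsum_of_nonneg (fun κ => cR_nonneg hx hy _ _) h2.summable]
  rw [tsum_succ_ennreal, tsum_succ_ennreal]
  simp [cE]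

lemma wE_eq {x y : ℝ} (hx : 0 ≤ x) (hx2 : x < 1/2) (hy : 0 ≤ y) (m : ℕ) (hm : 0 < m) :
    wE x y m = ENNReal.ofReal (y * (1 / (m:ℝ) + 1 / ((m:ℝ) - x))) := by
  have hm1 : (1:ℝ) ≤ m := by exact_mod_cast hm
  have h1 : wE x y m = ENNReal.ofReal (2 * y / m) + vE x y m := by
    rw [wE, vE, tsum_succ_ennreal, tsum_succ_ennreal,
      tsum_succ_ennreal (fun κ => if 2 ≤ κ then cE x y κ m else 0), tsum_succ_ennreal (fun κ => if 2 ≤ κ + 1 then cE x y (κ + 1) m else 0)]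
    simp [cE, cR, div_eq_mul_inv]
  have h3 : 1 / (m:ℝ) ≤ 1 / ((m:ℝ) - x) := by
    apply one_div_le_one_div_of_le <;> linarith
  rw [h1, vE_eq hx hx2 hy m hm, ← ENNReal.ofReal_add (by positivity)
    (mul_nonneg hy (by linarith))]
  congr 1
  ring

lemma tsum_snoc {n : ℕ} (f : (Fin (n+1) → ℕ) → ENNReal) :
    ∑' m, f m = ∑' j : ℕ, ∑' m' : Fin n → ℕ, f (Fin.snoc (α := fun _ => ℕ) m' j) := by
  rw [← ENNReal.tsum_prod (f := fun j m' => f (Fin.snoc (α := fun _ => ℕ) m' j)),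
    ← (Fin.snocEquiv (fun _ : Fin (n+1) => ℕ)).tsum_eq]
  rfl

lemma tsum_pi_prod : ∀ (n : ℕ) (f : Fin n → ℕ → ENNReal),
    ∑' κ : Fin n → ℕ, ∏ i, f i (κ i) = ∏ i, ∑' k, f i k := by
  intro n
  induction n with
  | zero =>
    intro f
    simp [tsum_fintype]
  | succ n ih =>
    intro f
    rw [tsum_snoc, Fin.prod_univ_castSucc]
    simp only [Fin.prod_univ_castSucc, Fin.snoc_castSucc, Fin.snoc_last]
    simp only [ENNReal.tsum_mul_right, ENNReal.tsum_mul_left]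
    rw [ih]

def adm (n : ℕ) (κ : Fin n → ℕ) : Prop :=
  (∀ i, 1 ≤ κ i) ∧ ∀ h : 0 < n, 2 ≤ κ ⟨n - 1, Nat.sub_lt h Nat.one_pos⟩

lemma adm_snoc {n : ℕ} (κ : Fin n → ℕ) (l : ℕ) :
    adm (n+1) (Fin.snoc (α := fun _ => ℕ) κ l) ↔ (∀ i, 1 ≤ κ i) ∧ 2 ≤ l := by
  unfold adm
  have e : (⟨n + 1 - 1, Nat.sub_lt (Nat.succ_pos n) Nat.one_pos⟩ : Fin (n+1)) = Fin.last n := rfl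
  simp only [e, Fin.snoc_last, Fin.forall_fin_succ', Fin.snoc_castSucc]
  constructor
  · rintro ⟨⟨h1, _⟩, h3⟩
    exact ⟨h1, h3 (Nat.succ_pos n)⟩
  · rintro ⟨h1, h2⟩
    exact ⟨⟨h1, by omega⟩, fun _ => h2⟩

lemma ath_snoc {n : ℕ} (m : Fin n → ℕ) (M : ℕ) :
    athCond (n+1) (Fin.snoc (α := fun _ => ℕ) m M) ↔
      athCond n m ∧ (∀ i, m i < M) ∧ M % 2 = (n+1) % 2 ∧ 0 < M := by
  unfold athCond
  simp only [Fin.forall_fin_succ', Fin.snoc_castSucc, Fin.snoc_last, Fin.val_castSucc, Fin.val_last]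
  constructor
  · rintro ⟨h1, h2, h3⟩
    refine ⟨⟨?_, h2⟩, ?_, h3⟩
    · intro i j hij
      have := h1 (show i.castSucc < j.castSucc from hij)
      simpa using this
    · intro i
      have := h1 (Fin.castSucc_lt_last i)
      simpa using this
  · rintro ⟨⟨h1, h2⟩, h3, h4⟩
    refine ⟨?_, h2, h4⟩
    intro i j
    refine Fin.lastCases ?_ (fun i => ?_) i <;> refine Fin.lastCases ?_ (fun j => ?_) j
    · intro h; exact absurd h (lt_irrefl _)
    · intro h; exact absurd (h.trans (Fin.castSucc_lt_last j)) (lt_irrefl _)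
    · intro _; simpa using h3 i
    · intro h; simpa using h1 (show i < j from h)

def SS (x y : ℝ) (n M : ℕ) : ENNReal :=
  ∑' m : Fin n → ℕ, if athCond (n+1) (Fin.snoc (α := fun _ => ℕ) m M) then ∏ i, wE x y (m i) else 0

lemma SS_parity (x y : ℝ) (n M : ℕ) (h : ¬ (M % 2 = (n+1) % 2 ∧ 0 < M)) : SS x y n M = 0 := by
  unfold SS
  rw [ENNReal.tsum_eq_zero]
  intro m
  rw [if_neg]
  rw [ath_snoc]
  tauto

lemma SS_zero (x y : ℝ) (M : ℕ) : SS x y 0 M = if M % 2 = 1 then 1 else 0 := by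
  unfold SS
  rw [tsum_fintype]
  have : ∀ m : Fin 0 → ℕ, athCond 0 m := fun m => ⟨fun i => i.elim0, fun i => i.elim0⟩
  simp only [ath_snoc, this, Finset.univ_unique, Finset.sum_singleton]
  simp
  congr 1
  simp
  omega

lemma SS_succ (x y : ℝ) (n M : ℕ) : SS x y (n+1) M =
    if M % 2 = n % 2 then ∑ j ∈ Finset.range M, wE x y j * SS x y n j else 0 := by
  rw [SS, tsum_snoc]
  have hterm : ∀ (j : ℕ) (m : Fin n → ℕ),
      (if athCond (n+1+1) (Fin.snoc (α := fun _ => ℕ) (Fin.snoc (α := fun _ => ℕ) m j) M) then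
        ∏ i, wE x y ((Fin.snoc (α := fun _ => ℕ) m j : Fin (n+1) → ℕ) i) else 0)
      = (if M % 2 = n % 2 ∧ j < M then wE x y j else 0) *
        (if athCond (n+1) (Fin.snoc (α := fun _ => ℕ) m j) then ∏ i, wE x y (m i) else 0) := by
    intro j m
    have hiff : athCond (n+1+1) (Fin.snoc (α := fun _ => ℕ) (Fin.snoc (α := fun _ => ℕ) m j) M) ↔
        (M % 2 = n % 2 ∧ j < M) ∧ athCond (n+1) (Fin.snoc (α := fun _ => ℕ) m j) := by
      rw [ath_snoc]
      simp only [Fin.forall_fin_succ', Fin.snoc_castSucc, Fin.snoc_last]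
      constructor
      · rintro ⟨h1, ⟨_, h3⟩, h4, h5⟩
        exact ⟨⟨by omega, h3⟩, h1⟩
      · rintro ⟨⟨h1, h2⟩, h3⟩
        refine ⟨h3, ⟨fun i => ?_, h2⟩, by omega, by omega⟩
        have := (ath_snoc m j).1 h3
        exact (this.2.1 i).trans h2
    rw [Fin.prod_univ_castSucc]
    simp only [Fin.snoc_castSucc, Fin.snoc_last]
    by_cases h1 : M % 2 = n % 2 ∧ j < M <;>
      by_cases h2 : athCond (n+1) (Fin.snoc (α := fun _ => ℕ) m j) <;>
      simp only [hiff, h1, h2, and_self, and_true, and_false, if_true, if_false, mul_zero, zero_mul]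
    rw [mul_comm]
  simp only [hterm, ENNReal.tsum_mul_left]
  rw [tsum_eq_sum (s := Finset.range M)]
  · split_ifs with h
    · apply Finset.sum_congr rfl
      intro j hj
      rw [if_pos ⟨h, Finset.mem_range.1 hj⟩]
      rfl
    · apply Finset.sum_eq_zero
      intro j hj
      rw [if_neg (by tauto), zero_mul]
  · intro j hj
    rw [if_neg, zero_mul]
    intro h
    exact hj (Finset.mem_range.2 h.2)

def QQ (x y : ℝ) (M : ℕ) : ENNReal := ∑' n, SS x y n M

lemma QQ_zero (x y : ℝ) : QQ x y 0 = 0 := by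
  unfold QQ
  rw [ENNReal.tsum_eq_zero]
  intro n
  exact SS_parity _ _ _ _ (by omega)


lemma QQ_one (x y : ℝ) : QQ x y 1 = 1 := by
  unfold QQ
  rw [tsum_succ_ennreal, SS_zero]
  have : ∀ n, SS x y (n+1) 1 = 0 := by
    intro n
    rw [SS_succ]
    simp [SS_parity x y n 0 (by omega)]
  simp [this]

lemma QQ_succ (x y : ℝ) (M : ℕ) : QQ x y (M+2) = QQ x y M + wE x y (M+1) * QQ x y (M+1) := by
  unfold QQ
  rw [tsum_succ_ennreal, tsum_succ_ennreal (fun n => SS x y n M), ← ENNReal.tsum_mul_left,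
    add_assoc, ← ENNReal.tsum_add]
  congr 1
  · rw [SS_zero, SS_zero]
    simp
  · apply tsum_congr
    intro n
    rw [SS_succ, SS_succ]
    by_cases h : M % 2 = n % 2
    · rw [if_pos h, if_pos (by omega), Finset.sum_range_succ, Finset.sum_range_succ,
        SS_parity x y n M (by omega), mul_zero, add_zero]
    · rw [if_neg h, if_neg (by omega), SS_parity x y n (M+1) (by omega), mul_zero, add_zero]

lemma QQ_eq {x y : ℝ} (hx : 0 ≤ x) (hx2 : x < 1/2) (hy : 0 ≤ y) : ∀ M,
    QQ x y M = ENNReal.ofReal (PP y (-x) M) ∧ QQ x y (M+1) = ENNReal.ofReal (PP y (-x) (M+1)) := by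
  intro M
  induction M with
  | zero => simp [QQ_zero, QQ_one, PP]
  | succ M ih =>
    refine ⟨ih.2, ?_⟩
    have h1 : (0:ℝ) ≤ M := Nat.cast_nonneg M
    have hw : 0 ≤ y * (1 / ((M : ℝ) + 1) + 1 / ((M : ℝ) + 1 + -x)) := by
      have : 0 < (M : ℝ) + 1 + -x := by linarith
      positivity
    rw [QQ_succ, ih.1, ih.2, wE_eq hx hx2 hy _ (by omega), PP,
      ENNReal.ofReal_add (PP_nn hy (by linarith) M) (mul_nonneg hw (PP_nn hy (by linarith) _)),
      ENNReal.ofReal_mul hw]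
    push_cast
    rfl

def VV (x y : ℝ) {n : ℕ} (κ : Fin n → ℕ) : ENNReal :=
  ∑' m : Fin n → ℕ, if athCond n m then ∏ i, cE x y (κ i) (m i) else 0

def UU (x y : ℝ) (n : ℕ) : ENNReal := ∑' κ : Fin n → ℕ, if adm n κ then VV x y κ else 0

lemma UU_succ (x y : ℝ) (n : ℕ) : UU x y (n+1) = ∑' M, vE x y M * SS x y n M := by
  have h1 : UU x y (n+1) = ∑' l : ℕ, ∑' κ : Fin n → ℕ, ∑' M : ℕ, ∑' m : Fin n → ℕ,
      (if athCond (n+1) (Fin.snoc (α := fun _ => ℕ) m M) then 1 else 0) *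
      ((if 2 ≤ l then cE x y l M else 0) * ∏ i, cE x y (κ i) (m i)) := by
    rw [UU, tsum_snoc]
    refine tsum_congr fun l => tsum_congr fun κ => ?_
    by_cases h : adm (n+1) (Fin.snoc (α := fun _ => ℕ) κ l)
    · rw [if_pos h, VV, tsum_snoc]
      refine tsum_congr fun M => tsum_congr fun m => ?_
      rw [adm_snoc] at h
      rw [if_pos h.2, Fin.prod_univ_castSucc]
      simp only [Fin.snoc_castSucc, Fin.snoc_last]
      split_ifs
      · ring
      · ring
    · rw [if_neg h]
      symm
      rw [ENNReal.tsum_eq_zero]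
      intro M
      rw [ENNReal.tsum_eq_zero]
      intro m
      rw [adm_snoc] at h
      by_cases hl : 2 ≤ l
      · have : ∃ i, κ i = 0 := by
          by_contra hc
          push Not at hc
          exact h ⟨fun i => Nat.one_le_iff_ne_zero.2 (hc i), hl⟩
        obtain ⟨i, hi⟩ := this
        rw [Finset.prod_eq_zero (Finset.mem_univ i)]
        · simp
        · simp [hi, cE, cR]
      · simp [hl]
  rw [h1]
  calc _ = ∑' l : ℕ, ∑' M : ℕ, ∑' κ : Fin n → ℕ, ∑' m : Fin n → ℕ,
      (if athCond (n+1) (Fin.snoc (α := fun _ => ℕ) m M) then (1:ENNReal) else 0) *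
      ((if 2 ≤ l then cE x y l M else 0) * ∏ i, cE x y (κ i) (m i)) :=
        tsum_congr fun l => ENNReal.tsum_comm
    _ = ∑' M : ℕ, ∑' l : ℕ, ∑' κ : Fin n → ℕ, ∑' m : Fin n → ℕ,
      (if athCond (n+1) (Fin.snoc (α := fun _ => ℕ) m M) then (1:ENNReal) else 0) *
      ((if 2 ≤ l then cE x y l M else 0) * ∏ i, cE x y (κ i) (m i)) := ENNReal.tsum_comm
    _ = ∑' M : ℕ, ∑' l : ℕ, ∑' m : Fin n → ℕ, ∑' κ : Fin n → ℕ,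
      (if athCond (n+1) (Fin.snoc (α := fun _ => ℕ) m M) then (1:ENNReal) else 0) *
      ((if 2 ≤ l then cE x y l M else 0) * ∏ i, cE x y (κ i) (m i)) :=
        tsum_congr fun M => tsum_congr fun l => ENNReal.tsum_comm
    _ = ∑' M, vE x y M * SS x y n M := by
        refine tsum_congr fun M => ?_
        simp only [ENNReal.tsum_mul_left]
        rw [vE, ← ENNReal.tsum_mul_right]
        refine tsum_congr fun l => ?_
        rw [SS, ← ENNReal.tsum_mul_left]
        refine tsum_congr fun m => ?_
        rw [tsum_pi_prod n (fun i k => cE x y k (m i))]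
        simp only [wE]
        split_ifs <;> simp

lemma UU_total {x y : ℝ} (hx : 0 ≤ x) (hx2 : x < 1/2) (hy : 0 ≤ y) (hy4 : y < 1/4) :
    ∑' n, UU x y (n+1) = ENNReal.ofReal (1 - HH y (-x)) := by
  have hsum := (hh_summable (y := y) (ξ := -x) hy hy4 (by linarith)).neg
  have hterm : ∀ M : ℕ, vE x y M * QQ x y M = ENNReal.ofReal (-hh y (-x) M) ∧ 0 ≤ -hh y (-x) M := by
    intro M
    rcases Nat.eq_zero_or_pos M with rfl | hM
    · simp [hh_zero, QQ_zero]
    have hm1 : (1:ℝ) ≤ M := by exact_mod_cast hM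
    have h3 : 1 / (M:ℝ) ≤ 1 / ((M:ℝ) - x) := by
      apply one_div_le_one_div_of_le <;> linarith
    have hv : 0 ≤ y * (1 / ((M:ℝ) - x) - 1 / M) := mul_nonneg hy (by linarith)
    have e : -hh y (-x) M = y * (1 / ((M:ℝ) - x) - 1 / M) * PP y (-x) M := by
      rw [hh]; ring
    rw [e]
    refine ⟨?_, mul_nonneg hv (PP_nn hy (by linarith) _)⟩
    rw [vE_eq hx hx2 hy M hM, (QQ_eq hx hx2 hy M).1, ENNReal.ofReal_mul hv]
  simp only [UU_succ]
  rw [ENNReal.tsum_comm]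
  simp only [ENNReal.tsum_mul_left]
  have : ∀ M, vE x y M * ∑' n, SS x y n M = ENNReal.ofReal (-hh y (-x) M) := fun M => (hterm M).1
  simp only [this]
  rw [← ENNReal.ofReal_tsum_of_nonneg (fun M => (hterm M).2) hsum, tsum_neg, HH]
  congr 1
  ring
/-! ### Linking with the multiple T-values -/

def ht {n : ℕ} (κ : Fin n → ℕ) : ℕ := (Finset.univ.filter fun i => 2 ≤ κ i).card

def DD {n : ℕ} (κ : Fin n → ℕ) : ENNReal :=
  ∑' m : Fin n → ℕ, if athCond n m then ENNReal.ofReal (∏ i, ((m i : ℝ) ^ κ i))⁻¹ else 0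

lemma Tval_eq {n : ℕ} (κ : Fin n → ℕ) : Tval κ = 2 ^ n * (DD κ).toReal := by
  unfold Tval DD
  rw [ENNReal.tsum_toReal_eq]
  · congr 1
    apply tsum_congr
    intro m
    split_ifs
    · rw [ENNReal.toReal_ofReal (by positivity)]
    · simp
  · intro m
    split_ifs
    · exact ENNReal.ofReal_ne_top
    · simp

def wt (x y : ℝ) {n : ℕ} (κ : Fin n → ℕ) : ℝ :=
  (1/2) ^ ht κ * 2 ^ n * x ^ (∑ i, κ i - n) * y ^ n

lemma prod_cR (x y : ℝ) {n : ℕ} (κ m : Fin n → ℕ) (hκ : ∀ i, 1 ≤ κ i) :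
    ∏ i, cR x y (κ i) (m i) = wt x y κ * (∏ i, ((m i : ℝ) ^ κ i))⁻¹ := by
  have h1 : ∀ i, cR x y (κ i) (m i) =
      2 * (if 2 ≤ κ i then 1 / 2 else 1) * x ^ (κ i - 1) * y * ((m i : ℝ) ^ κ i)⁻¹ := by
    intro i
    have := hκ i
    rw [cR, if_neg (by omega)]
  simp only [h1, Finset.prod_mul_distrib, Finset.prod_const, Finset.card_univ, Fintype.card_fin,
    Finset.prod_pow_eq_pow_sum, Finset.prod_inv_distrib]
  have h2 : ∑ i, (κ i - 1) = ∑ i, κ i - n := by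
    have : ∑ i, κ i = ∑ i, (κ i - 1) + n := by
      have h3 : ∀ i, κ i = (κ i - 1) + 1 := fun i => by have := hκ i; omega
      calc ∑ i, κ i = ∑ i, ((κ i - 1) + 1) := Finset.sum_congr rfl fun i _ => h3 i
        _ = _ := by rw [Finset.sum_add_distrib]; simp
    omega
  have h4 : ∏ i, (if 2 ≤ κ i then (1 / 2 : ℝ) else 1) = (1/2) ^ ht κ := by
    rw [Finset.prod_ite]
    simp [ht]
  rw [h2, h4, wt]
  ring

lemma VV_eq {x y : ℝ} (hx : 0 ≤ x) (hy : 0 ≤ y) {n : ℕ} (κ : Fin n → ℕ) (hκ : ∀ i, 1 ≤ κ i) :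
    VV x y κ = ENNReal.ofReal (wt x y κ) * DD κ := by
  unfold VV DD
  rw [← ENNReal.tsum_mul_left]
  apply tsum_congr
  intro m
  have hw : 0 ≤ wt x y κ := by unfold wt; positivity
  split_ifs
  · rw [← ENNReal.ofReal_mul hw, ← prod_cR x y κ m hκ,
      ENNReal.ofReal_prod_of_nonneg (fun i _ => cR_nonneg hx hy _ _)]
    rfl
  · simp

lemma DD_ne_top {n : ℕ} (κ : Fin n → ℕ) (hn : 1 ≤ n) (hκ : adm n κ) : DD κ ≠ ⊤ := by
  obtain ⟨n, rfl⟩ : ∃ n', n = n' + 1 := ⟨n - 1, by omega⟩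
  have ht := UU_total (x := 1/8) (y := 1/8) (by norm_num) (by norm_num) (by norm_num) (by norm_num)
  have h1 : UU (1/8) (1/8) (n+1) ≠ ⊤ := by
    intro h
    have : UU (1/8) (1/8) (n+1) ≤ ∑' n, UU (1/8) (1/8) (n+1) :=
      ENNReal.le_tsum (f := fun n => UU (1/8) (1/8) (n+1)) n
    rw [h, ht] at this
    exact absurd (lt_of_le_of_lt this ENNReal.ofReal_lt_top) (lt_irrefl _)
  have h2 : VV (1/8) (1/8) κ ≠ ⊤ := by
    intro h
    have : (if adm (n+1) κ then VV (1/8) (1/8) κ else 0) ≤ UU (1/8) (1/8) (n+1) :=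
      ENNReal.le_tsum (f := fun κ => if adm (n+1) κ then VV (1/8) (1/8) κ else 0) κ
    rw [if_pos hκ, h] at this
    exact h1 (top_le_iff.1 this)
  rw [VV_eq (by norm_num) (by norm_num) κ hκ.1] at h2
  intro h
  rw [h, ENNReal.mul_top] at h2
  · exact h2 rfl
  · rw [ne_eq, ENNReal.ofReal_eq_zero, not_le]
    unfold wt
    positivity

def AA (k n : ℕ) : ℝ := ∑ s ∈ Finset.Icc 1 n, (1 / 2 : ℝ) ^ s * sumT0 k n s

def KK (k n : ℕ) : Finset (Fin n → ℕ) := Fintype.piFinset fun _ => Finset.range (k + 1)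

lemma mem_KK {k n : ℕ} {κ : Fin n → ℕ} (h : ∑ i, κ i = k) : κ ∈ KK k n := by
  unfold KK
  rw [Fintype.mem_piFinset]
  intro i
  rw [Finset.mem_range]
  have : κ i ≤ ∑ i, κ i := Finset.single_le_sum (f := κ) (fun _ _ => Nat.zero_le _) (Finset.mem_univ i)
  omega

lemma AA_eq (k n : ℕ) (hn : 1 ≤ n) : AA k n =
    ∑ κ ∈ KK k n, if adm n κ ∧ ∑ i, κ i = k then (1/2) ^ ht κ * (2 ^ n * (DD κ).toReal) else 0 := by
  have h1 : ∀ s, sumT0 k n s = ∑ κ ∈ KK k n, if IdxCond0 k n s κ then Tval κ else 0 := by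
    intro s
    unfold sumT0
    apply tsum_eq_sum
    intro κ hκ
    rw [if_neg]
    intro h
    exact hκ (mem_KK h.1.2.1)
  unfold AA
  simp only [h1, Finset.mul_sum]
  rw [Finset.sum_comm]
  apply Finset.sum_congr rfl
  intro κ _
  have hiff : ∀ s, IdxCond0 k n s κ ↔ (adm n κ ∧ ∑ i, κ i = k) ∧ ht κ = s := by
    intro s
    unfold IdxCond0 IdxCond adm ht
    tauto
  simp only [hiff]
  by_cases h : adm n κ ∧ ∑ i, κ i = k
  · simp only [h, true_and, and_self, if_true]
    rw [Finset.sum_eq_single (ht κ)]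
    · rw [if_pos rfl, Tval_eq]
    · intro s _ hs
      rw [if_neg (Ne.symm hs), mul_zero]
    · intro hs
      exfalso
      apply hs
      rw [Finset.mem_Icc]
      constructor
      · unfold ht
        rw [Nat.one_le_iff_ne_zero, Finset.card_ne_zero]
        exact ⟨_, Finset.mem_filter.2 ⟨Finset.mem_univ _, h.1.2 (by omega)⟩⟩
      · unfold ht
        refine (Finset.card_filter_le _ _).trans ?_
        simp
  · simp [h]

def tR (x y : ℝ) (p : ℕ × ℕ) : ℝ :=
  if 1 ≤ p.2 ∧ p.2 < p.1 then AA p.1 p.2 * x ^ (p.1 - p.2) * y ^ p.2 else 0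

lemma AA_nonneg (k n : ℕ) (hn : 1 ≤ n) : 0 ≤ AA k n := by
  rw [AA_eq k n hn]
  apply Finset.sum_nonneg
  intro κ _
  split_ifs <;> positivity

lemma tR_nonneg {x y : ℝ} (hx : 0 ≤ x) (hy : 0 ≤ y) (p : ℕ × ℕ) : 0 ≤ tR x y p := by
  unfold tR
  split_ifs with h
  · have := AA_nonneg p.1 p.2 h.1
    positivity
  · rfl

lemma adm_lt {n : ℕ} (hn : 1 ≤ n) {κ : Fin n → ℕ} (h : adm n κ) : n < ∑ i, κ i := by
  have : ∑ i : Fin n, 1 < ∑ i, κ i :=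
    Finset.sum_lt_sum (fun i _ => h.1 i) ⟨_, Finset.mem_univ _, h.2 (by omega)⟩
  simpa using this

lemma tR_ofReal {x y : ℝ} (hx : 0 ≤ x) (hy : 0 ≤ y) (k n : ℕ) (hn : 1 ≤ n) :
    ENNReal.ofReal (tR x y (k, n)) =
      ∑' κ : Fin n → ℕ, if ∑ i, κ i = k then (if adm n κ then VV x y κ else 0) else 0 := by
  rw [tsum_eq_sum (s := KK k n)]
  · by_cases hk : n < k
    · unfold tR
      simp only
      rw [if_pos ⟨hn, hk⟩, AA_eq k n hn, Finset.sum_mul, Finset.sum_mul,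
        ENNReal.ofReal_sum_of_nonneg]
      · apply Finset.sum_congr rfl
        intro κ _
        by_cases h1 : ∑ i, κ i = k <;> by_cases h2 : adm n κ <;> simp only [h1, h2, if_true, if_false, and_self, and_true, and_false, zero_mul, ENNReal.ofReal_zero]
        rw [VV_eq hx hy κ h2.1]
        conv_rhs => rw [← ENNReal.ofReal_toReal (DD_ne_top κ hn h2)]
        rw [← ENNReal.ofReal_mul (by unfold wt; positivity), wt, h1]
        congr 1
        ring
      · intro κ _
        split_ifs <;> positivity
    · unfold tR
      simp only
      rw [if_neg (by tauto), ENNReal.ofReal_zero]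
      symm
      apply Finset.sum_eq_zero
      intro κ _
      split_ifs with h1 h2
      · have := adm_lt hn h2
        omega
      · rfl
      · rfl
  · intro κ hκ
    rw [if_neg]
    intro h
    exact hκ (mem_KK h)

lemma tR_total {x y : ℝ} (hx : 0 ≤ x) (hx2 : x < 1/2) (hy : 0 ≤ y) (hy4 : y < 1/4) :
    ∑' p, ENNReal.ofReal (tR x y p) = ENNReal.ofReal (1 - HH y (-x)) := by
  rw [← UU_total hx hx2 hy hy4, ENNReal.tsum_prod (f := fun k n => ENNReal.ofReal (tR x y (k, n))),
    ENNReal.tsum_comm, tsum_succ_ennreal]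
  have h0 : ∑' k, ENNReal.ofReal (tR x y (k, 0)) = 0 := by
    simp [tR]
  rw [h0, zero_add]
  apply tsum_congr
  intro n
  simp only [tR_ofReal hx hy _ (n+1) (by omega)]
  rw [ENNReal.tsum_comm, UU]
  apply tsum_congr
  intro κ
  rw [tsum_eq_single (∑ i, κ i)]
  · rw [if_pos rfl]
  · intro k hk
    rw [if_neg (Ne.symm hk)]

lemma tR_summable {x y : ℝ} (hx : 0 ≤ x) (hx2 : x < 1/2) (hy : 0 ≤ y) (hy4 : y < 1/4) :
    Summable (tR x y) := by
  have h : ∑' p, ENNReal.ofReal (tR x y p) ≠ ⊤ := by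
    rw [tR_total hx hx2 hy hy4]; exact ENNReal.ofReal_ne_top
  have := ENNReal.summable_toReal h
  simpa only [ENNReal.toReal_ofReal (tR_nonneg hx hy _)] using this

lemma HH_le_one {x y : ℝ} (hx : 0 ≤ x) (hx2 : x < 1/2) (hy : 0 ≤ y) : HH y (-x) ≤ 1 := by
  unfold HH
  have : ∑' m, hh y (-x) m ≤ 0 := by
    apply tsum_nonpos
    intro M
    rcases Nat.eq_zero_or_pos M with rfl | hM
    · simp [hh_zero]
    have hm1 : (1:ℝ) ≤ M := by exact_mod_cast hM
    have h3 : 1 / (M:ℝ) ≤ 1 / ((M:ℝ) + -x) := by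
      apply one_div_le_one_div_of_le <;> linarith
    have e : -hh y (-x) M = y * (1 / ((M:ℝ) + -x) - 1 / M) * PP y (-x) M := by
      rw [hh]; ring
    have : 0 ≤ -hh y (-x) M := by
      rw [e]
      exact mul_nonneg (mul_nonneg hy (by linarith)) (PP_nn hy (by linarith) _)
    linarith
  linarith

lemma tR_tsum {x y : ℝ} (hx : 0 ≤ x) (hx2 : x < 1/2) (hy : 0 ≤ y) (hy4 : y < 1/4) :
    1 - ∑' p, tR x y p = HH y (-x) := by
  have h1 := tR_total hx hx2 hy hy4
  rw [← ENNReal.ofReal_tsum_of_nonneg (tR_nonneg hx hy) (tR_summable hx hx2 hy hy4),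
    ENNReal.ofReal_eq_ofReal_iff (tsum_nonneg (tR_nonneg hx hy))
      (by linarith [HH_le_one hx hx2 hy])] at h1
  linarith

/-! Complex assembly -/

def fC (x y : ℂ) (p : ℕ × ℕ) : ℂ :=
  if 1 ≤ p.2 ∧ p.2 < p.1 then
    ((∑ s ∈ Finset.Icc 1 p.2, (1 / 2 : ℝ) ^ s * sumT0 p.1 p.2 s : ℝ) : ℂ)
      * x ^ (p.1 - p.2) * y ^ p.2
  else 0

def gC (x y : ℂ) (n : ℕ) : ℂ :=
  if 2 ≤ n then ((Tval ![n] : ℝ) : ℂ) / (2 * n) * (x ^ n + y ^ n - (x + y) ^ n)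
  else 0

theorem fC_norm_le (x y : ℂ) (r ρ : ℝ) (hx : ‖x‖ ≤ r) (hy : ‖y‖ ≤ ρ) (p : ℕ × ℕ) :
    ‖fC x y p‖ ≤ tR r ρ p := by
  unfold fC tR
  split_ifs with h
  · have hA := AA_nonneg p.1 p.2 h.1
    change ‖((AA p.1 p.2 : ℝ) : ℂ) * _ * _‖ ≤ _
    rw [norm_mul, norm_mul, norm_pow, norm_pow, Complex.norm_real, Real.norm_of_nonneg hA]
    have : 0 ≤ r := (norm_nonneg _).trans hx
    gcongr
  · simp

theorem gC_norm_le (x y : ℂ) (r ρ : ℝ) (hx : ‖x‖ ≤ r) (hy : ‖y‖ ≤ ρ) (n : ℕ) :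
    ‖gC x y n‖ ≤ bb r n + bb ρ n + bb (r + ρ) n := by
  unfold gC bb
  split_ifs with h
  · rw [Tval_single, norm_mul]
    have hl := lam_nonneg n
    have hn : (0:ℝ) < n := by exact_mod_cast (by omega : 0 < n)
    have e : ‖((2 * lam n : ℝ) : ℂ) / (2 * n)‖ = lam n / n := by
      have : ((2 * lam n : ℝ) : ℂ) / (2 * n) = ((lam n / n : ℝ) : ℂ) := by
        push_cast
        rw [mul_div_mul_left _ _ two_ne_zero]
      rw [this, Complex.norm_real, Real.norm_of_nonneg (by positivity)]
    rw [e]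
    have hb : ‖x ^ n + y ^ n - (x + y) ^ n‖ ≤ r ^ n + ρ ^ n + (r + ρ) ^ n := by
      refine (norm_sub_le _ _).trans ?_
      refine add_le_add ((norm_add_le _ _).trans ?_) ?_
      · rw [norm_pow, norm_pow]; gcongr
      · rw [norm_pow]
        have := (norm_add_le x y).trans (add_le_add hx hy)
        gcongr
    calc lam n / n * ‖x ^ n + y ^ n - (x + y) ^ n‖
        ≤ lam n / n * (r ^ n + ρ ^ n + (r + ρ) ^ n) := by gcongr
      _ = _ := by ring
  · simp

theorem gB_summable (r ρ : ℝ) (hr : 0 ≤ r) (hr2 : r < 1 / 2) (hρ : 0 ≤ ρ) (hρ4 : ρ < 1 / 4) :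
    Summable (fun n => bb r n + bb ρ n + bb (r + ρ) n) :=
  ((bb_summable hr (by linarith)).add (bb_summable hρ (by linarith))).add
    (bb_summable (by linarith) (by linarith))

theorem real_case (x y : ℝ) (hx : 0 ≤ x) (hx2 : x < 1 / 2) (hy : 0 ≤ y) (hy4 : y < 1 / 4) :
    1 - ∑' p, fC x y p = Complex.exp (∑' n, gC x y n) := by
  have h1 : ∀ p, fC x y p = ((tR x y p : ℝ) : ℂ) := by
    intro p
    unfold fC tR AA
    split_ifs with h
    · push_cast; rfl
    · simp
  have h2 : ∀ n, gC x y n = ((bb x n + bb y n - bb (x + y) n : ℝ) : ℂ) := by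
    intro n
    unfold gC bb
    split_ifs with h
    · rw [Tval_single]
      push_cast
      rw [mul_div_mul_left _ _ two_ne_zero]
      ring
    · simp
  rw [tsum_congr h1, tsum_congr h2, ← Complex.ofReal_tsum, ← Complex.ofReal_tsum,
    ← Complex.ofReal_exp, real_rhs hy hy4 hx hx2, ← tR_tsum hx hx2 hy hy4]
  push_cast
  rfl

theorem ident_ball (f g : ℂ → ℂ) (r : ℝ) (hr : 0 < r) (hf : DifferentiableOn ℂ f (ball 0 r))
    (hg : DifferentiableOn ℂ g (ball 0 r)) (h : ∀ t : ℝ, 0 ≤ t → t < r → f t = g t) (z : ℂ)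
    (hz : ‖z‖ < r) : f z = g z := by
  have hf' := hf.analyticOnNhd isOpen_ball
  have hg' := hg.analyticOnNhd isOpen_ball
  refine hf'.eqOn_of_preconnected_of_frequently_eq hg' (convex_ball (0:ℂ) r).isPreconnected
    (mem_ball_self hr) ?_ (by simpa using hz)
  have ht : Tendsto (fun t : ℝ => (t : ℂ)) (nhdsWithin 0 (Set.Ioi 0)) (nhdsWithin 0 {0}ᶜ) := by
    refine tendsto_nhdsWithin_iff.2 ⟨?_, ?_⟩
    · have : Tendsto (fun t : ℝ => (t : ℂ)) (nhds 0) (nhds ((0:ℝ) : ℂ)) :=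
        Complex.continuous_ofReal.tendsto 0
      simpa using this.mono_left nhdsWithin_le_nhds
    · filter_upwards [self_mem_nhdsWithin] with t ht
      have : t ≠ 0 := (Set.mem_Ioi.1 ht).ne'
      simpa using this
  refine ht.frequently (Eventually.frequently ?_)
  filter_upwards [Ioo_mem_nhdsGT hr] with t ht
  exact h t ht.1.le ht.2

theorem complex_case (x y : ℂ) (hx : ‖x‖ < 1 / 2) (hy : ‖y‖ < 1 / 4) :
    1 - ∑' p, fC x y p = Complex.exp (∑' n, gC x y n) := by
  obtain ⟨r, hxr, hr2⟩ := exists_between hx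
  obtain ⟨ρ, hyρ, hρ4⟩ := exists_between hy
  have hr : 0 < r := (norm_nonneg _).trans_lt hxr
  have hρ : 0 < ρ := (norm_nonneg _).trans_lt hyρ
  have hS1 := tR_summable hr.le hr2 hρ.le hρ4
  have hS2 := gB_summable r ρ hr.le hr2 hρ.le hρ4
  have step1 : ∀ y : ℝ, 0 ≤ y → y < ρ → ∀ x : ℂ, ‖x‖ < r →
      1 - ∑' p, fC x y p = Complex.exp (∑' n, gC x y n) := by
    intro y hy0 hy x hx
    have hyn : ‖(y:ℂ)‖ ≤ ρ := by
      rw [Complex.norm_real, Real.norm_of_nonneg hy0]; exact hy.le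
    refine ident_ball (fun x => 1 - ∑' p, fC x y p) (fun x => Complex.exp (∑' n, gC x y n)) r hr
      ?_ ?_ ?_ x hx
    · refine (differentiableOn_const _).sub
        (differentiableOn_tsum_of_summable_norm hS1 ?_ isOpen_ball ?_)
      · intro p
        unfold fC
        split_ifs <;> fun_prop
      · intro p w hw
        exact fC_norm_le _ _ _ _ (by simpa using (mem_ball.1 hw).le) hyn p
    · refine DifferentiableOn.cexp
        (differentiableOn_tsum_of_summable_norm hS2 ?_ isOpen_ball ?_)
      · intro p
        unfold gC
        split_ifs <;> fun_prop
      · intro p w hw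
        exact gC_norm_le _ _ _ _ (by simpa using (mem_ball.1 hw).le) hyn p
    · intro t ht0 ht
      exact real_case t y ht0 (ht.trans hr2) hy0 (hy.trans hρ4)
  refine ident_ball (fun y => 1 - ∑' p, fC x y p) (fun y => Complex.exp (∑' n, gC x y n)) ρ hρ
      ?_ ?_ ?_ y hyρ
  · refine (differentiableOn_const _).sub
      (differentiableOn_tsum_of_summable_norm hS1 ?_ isOpen_ball ?_)
    · intro p
      unfold fC
      split_ifs <;> fun_prop
    · intro p w hw
      exact fC_norm_le _ _ _ _ hxr.le (by simpa using (mem_ball.1 hw).le) p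
  · refine DifferentiableOn.cexp
      (differentiableOn_tsum_of_summable_norm hS2 ?_ isOpen_ball ?_)
    · intro p
      unfold gC
      split_ifs <;> fun_prop
    · intro p w hw
      exact gC_norm_le _ _ _ _ hxr.le (by simpa using (mem_ball.1 hw).le) p
  · intro t ht0 ht
    exact step1 t ht0 ht x hxr

/-- Main theorem: for `|x| < 1/2`, `|y| < 1/4`, both series converge absolutely and
`1 − Σ_{k>n≥1} (Σ_{s=1}^{n} 2^{−s} Σ_{𝐤∈I₀(k,n,s)} T(𝐤)) x^{k−n} y^{n}
  = exp( Σ_{n≥2} (T(n)/(2n)) (x^n + y^n − (x+y)^n) )`. -/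
theorem main_generating_function (x y : ℂ) (hx : ‖x‖ < 1 / 2) (hy : ‖y‖ < 1 / 4) :
    Summable (fun p : ℕ × ℕ =>
      ‖if 1 ≤ p.2 ∧ p.2 < p.1 then
          ((∑ s ∈ Finset.Icc 1 p.2, (1 / 2 : ℝ) ^ s * sumT0 p.1 p.2 s : ℝ) : ℂ)
            * x ^ (p.1 - p.2) * y ^ p.2
        else 0‖) ∧
    Summable (fun n : ℕ =>
      ‖if 2 ≤ n then ((Tval ![n] : ℝ) : ℂ) / (2 * n) * (x ^ n + y ^ n - (x + y) ^ n)
        else 0‖) ∧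
    1 - (∑' p : ℕ × ℕ,
        if 1 ≤ p.2 ∧ p.2 < p.1 then
          ((∑ s ∈ Finset.Icc 1 p.2, (1 / 2 : ℝ) ^ s * sumT0 p.1 p.2 s : ℝ) : ℂ)
            * x ^ (p.1 - p.2) * y ^ p.2
        else 0)
      = Complex.exp (∑' n : ℕ,
          if 2 ≤ n then ((Tval ![n] : ℝ) : ℂ) / (2 * n) * (x ^ n + y ^ n - (x + y) ^ n)
          else 0) := by
  refine ⟨?_, ?_, complex_case x y hx hy⟩
  · exact Summable.of_nonneg_of_le (fun _ => norm_nonneg _)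
      (fC_norm_le x y ‖x‖ ‖y‖ le_rfl le_rfl)
      (tR_summable (norm_nonneg _) hx (norm_nonneg _) hy)
  · exact Summable.of_nonneg_of_le (fun _ => norm_nonneg _)
      (gC_norm_le x y ‖x‖ ‖y‖ le_rfl le_rfl)
      (gB_summable _ _ (norm_nonneg _) hx (norm_nonneg _) hy)

end
end

section
/- For every integer k ≥ 3, −( (1/2) T(1, k−1) + (1/4) Σ_{j=2}^{k−2} T(k−j, j) ) = −((k−1)/4) T(k) + (1/8) Σ_{j=2}^{k−2} T(j) T(k−j), where the sums over j are empty when k = 3. -/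
open Complex Filter Metric Finset

attribute [local instance] Classical.propDecidable

noncomputable section

lemma w_aux_summable :
    Summable (fun p : ℕ × ℕ => ((√((p.1:ℝ)+1))^3)⁻¹ * ((√((p.2:ℝ)+1))^3)⁻¹) := by
  have h : Summable (fun i : ℕ => ((√((i:ℝ)+1))^3)⁻¹) := by
    have h1 := (Real.summable_nat_rpow_inv (p := 3/2)).2 (by norm_num)
    have h2 := (summable_nat_add_iff 1).2 h1
    refine h2.congr fun i => ?_
    have : (0:ℝ) ≤ (i:ℝ)+1 := by positivity
    rw [Real.sqrt_eq_rpow, ← Real.rpow_natCast, ← Real.rpow_mul this]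
    push_cast
    norm_num
  exact h.mul_of_nonneg h (fun i => by positivity) (fun i => by positivity)

lemma w_bound1 (i j : ℕ) (x e : ℝ) (hx : (i:ℝ)+1 ≤ x) (he : (j:ℝ)+1 ≤ e) :
    x⁻¹ * e⁻¹ * (x+e)⁻¹ ≤ ((√((i:ℝ)+1))^3)⁻¹ * ((√((j:ℝ)+1))^3)⁻¹ := by
  have hp : 0 < √((i:ℝ)+1) := Real.sqrt_pos.2 (by positivity)
  have hr : 0 < √((j:ℝ)+1) := Real.sqrt_pos.2 (by positivity)
  have hp2 : √((i:ℝ)+1)^2 = (i:ℝ)+1 := Real.sq_sqrt (by positivity)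
  have hr2 : √((j:ℝ)+1)^2 = (j:ℝ)+1 := Real.sq_sqrt (by positivity)
  rw [← hp2] at hx
  rw [← hr2] at he
  generalize √((i:ℝ)+1) = p at *
  generalize √((j:ℝ)+1) = r at *
  have hx0 : 0 < x := lt_of_lt_of_le (by positivity) hx
  have he0 : 0 < e := lt_of_lt_of_le (by positivity) he
  rw [← mul_inv, ← mul_inv, ← mul_inv]
  apply inv_anti₀ (by positivity)
  calc p^3*r^3 = p^2 * r^2 * (p*r) := by ring
    _ ≤ x * e * (x+e) := by
      have : p * r ≤ x + e := by nlinarith [sq_nonneg (p-r)]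
      gcongr

lemma w_bound2 (i j : ℕ) (x e : ℝ) (hx : (i:ℝ)+1 ≤ x) (he : (j:ℝ)+1 ≤ e) :
    x⁻¹ * (x+e)⁻¹ ^ 2 ≤ ((√((i:ℝ)+1))^3)⁻¹ * ((√((j:ℝ)+1))^3)⁻¹ := by
  refine le_trans ?_ (w_bound1 i j x e hx he)
  have hx0 : 0 < x := lt_of_lt_of_le (by positivity) hx
  have he0 : 0 < e := lt_of_lt_of_le (by positivity) he
  rw [sq, ← mul_assoc]
  have : (x+e)⁻¹ ≤ e⁻¹ := by
    apply inv_anti₀ he0; linarith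
  gcongr

lemma w_Tval1 (k : ℕ) : Tval ![k] = 2 * ∑' i : ℕ, ((2*(i:ℝ)+1)⁻¹)^k := by
  unfold Tval
  have hg : Function.Injective (fun i : ℕ => (![2*i+1] : Fin 1 → ℕ)) := by
    intro a b h
    have := congrFun h 0
    simp at this
    exact this
  rw [← hg.tsum_eq]
  · simp only [pow_one]
    congr 1
    apply tsum_congr
    intro i
    rw [if_pos]
    · simp
    · refine ⟨?_, ?_⟩
      · intro a b h; omega
      · intro a; fin_cases a; simp
  · intro m hm
    simp only [Function.mem_support, ne_eq, ite_eq_right_iff, not_forall] at hm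
    obtain ⟨hm, -⟩ := hm
    have := hm.2 0
    simp at this
    refine ⟨m 0 / 2, ?_⟩
    ext a; fin_cases a; simp; omega

lemma w_Tval2 (a b : ℕ) : Tval ![a,b] =
    4 * ∑' p : ℕ × ℕ, ((2*(p.1:ℝ)+1)⁻¹)^a * (((2*(p.1:ℝ)+1)+(2*(p.2:ℝ)+1))⁻¹)^b := by
  unfold Tval
  have hg : Function.Injective (fun p : ℕ × ℕ => (![2*p.1+1, 2*p.1+2*p.2+2] : Fin 2 → ℕ)) := by
    rintro ⟨a, b⟩ ⟨c, d⟩ h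
    have h0 := congrFun h 0
    have h1 := congrFun h 1
    simp at h0 h1
    ext <;> simp <;> omega
  rw [← hg.tsum_eq]
  · norm_num
    apply tsum_congr
    intro i
    rw [if_pos]
    · rw [show 2 * (i.1:ℝ) + 2 * i.2 + 2 = 2*(i.1:ℝ)+1+(2*(i.2:ℝ)+1) by ring]
      ring
    · refine ⟨?_, ?_⟩
      · intro a b h
        fin_cases a <;> fin_cases b <;> simp at h ⊢ <;> omega
      · intro a; fin_cases a <;> simp <;> omega
  · intro m hm
    simp only [Function.mem_support, ne_eq, ite_eq_right_iff, not_forall] at hm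
    obtain ⟨hm, -⟩ := hm
    have h0 := hm.2 0
    have h1 := hm.2 1
    have h2 : m 0 < m 1 := hm.1 (by simp)
    simp at h0 h1
    refine ⟨(m 0 / 2, (m 1 - m 0)/2), ?_⟩
    ext a; fin_cases a <;> simp <;> omega

lemma w_split (F : ℕ × ℕ → ℝ) (hF : Summable F) :
    ∑' p, F p = ∑' i : ℕ, F (i,i) + ∑' p : ℕ × ℕ, F (p.1, p.1+p.2+1)
      + ∑' p : ℕ × ℕ, F (p.1+p.2+1, p.1) := by
  have h1 : Function.Injective (fun i : ℕ => (i,i)) := fun a b h => by simpa using h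
  have h2 : Function.Injective (fun p : ℕ × ℕ => (p.1, p.1+p.2+1)) := by
    rintro ⟨a, b⟩ ⟨c, d⟩ h
    simp at h ⊢; omega
  have h3 : Function.Injective (fun p : ℕ × ℕ => (p.1+p.2+1, p.1)) := by
    rintro ⟨a, b⟩ ⟨c, d⟩ h
    simp at h ⊢; omega
  have e1 := h1.tsum_eq (f := Set.indicator {p : ℕ × ℕ | p.1 = p.2} F) (by
    rintro ⟨a, b⟩ hm
    have := Set.mem_of_indicator_ne_zero hm
    exact ⟨a, by simpa using this⟩)
  have e2 := h2.tsum_eq (f := Set.indicator {p : ℕ × ℕ | p.1 < p.2} F) (by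
    rintro ⟨a, b⟩ hm
    have := Set.mem_of_indicator_ne_zero hm
    simp at this
    exact ⟨(a, b-a-1), by simp; omega⟩)
  have e3 := h3.tsum_eq (f := Set.indicator {p : ℕ × ℕ | p.2 < p.1} F) (by
    rintro ⟨a, b⟩ hm
    have := Set.mem_of_indicator_ne_zero hm
    simp at this
    exact ⟨(b, a-b-1), by simp; omega⟩)
  have f1 : ∑' i : ℕ, F (i,i) = ∑' p, Set.indicator {p : ℕ × ℕ | p.1 = p.2} F p := by
    rw [← e1]; apply tsum_congr; intro i; simp
  have f2 : ∑' p : ℕ × ℕ, F (p.1, p.1+p.2+1) = ∑' p, Set.indicator {p : ℕ × ℕ | p.1 < p.2} F p := by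
    rw [← e2]; apply tsum_congr; intro i
    rw [Set.indicator_of_mem]; simp only [Set.mem_setOf_eq]; omega
  have f3 : ∑' p : ℕ × ℕ, F (p.1+p.2+1, p.1) = ∑' p, Set.indicator {p : ℕ × ℕ | p.2 < p.1} F p := by
    rw [← e3]; apply tsum_congr; intro i
    rw [Set.indicator_of_mem]; simp only [Set.mem_setOf_eq]; omega
  rw [f1, f2, f3, ← (hF.indicator _).tsum_add (hF.indicator _),
    ← ((hF.indicator _).add (hF.indicator _)).tsum_add (hF.indicator _)]
  apply tsum_congr
  rintro ⟨a, b⟩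
  rcases lt_trichotomy a b with h | h | h
  · simp [Set.indicator, h, h.ne, h.le, h.not_gt]
  · simp [Set.indicator, h]
  · simp [Set.indicator, h, h.ne', h.le, h.not_gt]

def wH (n : ℕ) : ℝ := ∑ l ∈ Finset.range n, ((l:ℝ)+1)⁻¹

lemma wH_succ (n : ℕ) : wH (n+1) = wH n + ((n:ℝ)+1)⁻¹ := by
  simp [wH, Finset.sum_range_succ]

lemma w_tele (x : ℕ) : HasSum (fun l : ℕ => ((l:ℝ)+1)⁻¹ - ((x:ℝ) + ((l:ℝ)+1))⁻¹) (wH x) := by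
  induction x with
  | zero => simpa [wH] using (hasSum_zero (α := ℝ) (β := ℕ))
  | succ n ih =>
    rw [wH_succ]
    have h : HasSum (fun l : ℕ => ((n:ℝ) + ((l:ℝ)+1))⁻¹ - (((n+1:ℕ):ℝ) + ((l:ℝ)+1))⁻¹)
        (((n:ℝ)+1)⁻¹) := by
      rw [hasSum_iff_tendsto_nat_of_nonneg]
      · have e : ∀ N : ℕ, ∑ l ∈ Finset.range N, (((n:ℝ) + ((l:ℝ)+1))⁻¹ - (((n+1:ℕ):ℝ) + ((l:ℝ)+1))⁻¹)
            = ((n:ℝ)+1)⁻¹ - ((N:ℝ) + ((n:ℝ)+1))⁻¹ := by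
          intro N
          have := Finset.sum_range_sub' (fun l : ℕ => ((n:ℝ) + ((l:ℝ)+1))⁻¹) N
          rw [show ((N:ℝ) + ((n:ℝ)+1)) = (n:ℝ)+(N+1) by ring]
          convert this using 3
          · push_cast; ring
          · push_cast; ring
        simp_rw [e]
        have : Tendsto (fun N : ℕ => ((N:ℝ) + ((n:ℝ)+1))⁻¹) atTop (nhds 0) :=
          tendsto_inv_atTop_zero.comp
            (tendsto_atTop_add_const_right _ _ tendsto_natCast_atTop_atTop)
        simpa using (tendsto_const_nhds (x := ((n:ℝ)+1)⁻¹)).sub this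
      · intro l
        rw [sub_nonneg]
        apply inv_anti₀ (by positivity)
        push_cast; linarith
    refine (ih.add h).congr_fun ?_
    intro l
    simp

lemma w_inner (x : ℕ) (hx : 0 < x) :
    HasSum (fun l : ℕ => ((l:ℝ)+1)⁻¹ * ((x:ℝ) + ((l:ℝ)+1))⁻¹) ((x:ℝ)⁻¹ * wH x) := by
  refine ((w_tele x).mul_left ((x:ℝ)⁻¹)).congr_fun ?_
  intro l
  have : (x:ℝ) ≠ 0 := by positivity
  have : (l:ℝ) + 1 ≠ 0 := by positivity
  have : (x:ℝ) + ((l:ℝ) + 1) ≠ 0 := by positivity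
  field_simp
  ring

lemma w_inner2 (i : ℕ) :
    (∑' j : ℕ, (2*(j:ℝ)+1)⁻¹ * ((2*(i:ℝ)+1) + (2*(j:ℝ)+1))⁻¹)
    + (∑' j : ℕ, (2*(j:ℝ)+2)⁻¹ * ((2*(i:ℝ)+1) + (2*(j:ℝ)+2))⁻¹)
      = (2*(i:ℝ)+1)⁻¹ * wH (2*i+1) := by
  have h := w_inner (2*i+1) (by omega)
  have hs := h.summable
  have h1 : Summable (fun j : ℕ => (((2*j:ℕ):ℝ)+1)⁻¹ * (((2*i+1:ℕ):ℝ) + (((2*j:ℕ):ℝ)+1))⁻¹) :=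
    hs.comp_injective (i := fun j : ℕ => 2*j) (fun a b h => by simpa using h)
  have h2 : Summable (fun j : ℕ => (((2*j+1:ℕ):ℝ)+1)⁻¹ * (((2*i+1:ℕ):ℝ) + (((2*j+1:ℕ):ℝ)+1))⁻¹) :=
    hs.comp_injective (i := fun j : ℕ => 2*j+1) (fun a b h => by simpa using h)
  have h3 := tsum_even_add_odd
    (f := fun l : ℕ => ((l:ℝ)+1)⁻¹ * (((2*i+1:ℕ):ℝ) + ((l:ℝ)+1))⁻¹) h1 h2
  rw [h.tsum_eq] at h3
  have e1 : ∀ j : ℕ, (2*(j:ℝ)+1)⁻¹ * ((2*(i:ℝ)+1) + (2*(j:ℝ)+1))⁻¹ =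
      (((2*j:ℕ):ℝ)+1)⁻¹ * (((2*i+1:ℕ):ℝ) + (((2*j:ℕ):ℝ)+1))⁻¹ := by
    intro j; push_cast; rfl
  have e2 : ∀ j : ℕ, (2*(j:ℝ)+2)⁻¹ * ((2*(i:ℝ)+1) + (2*(j:ℝ)+2))⁻¹ =
      (((2*j+1:ℕ):ℝ)+1)⁻¹ * (((2*i+1:ℕ):ℝ) + (((2*j+1:ℕ):ℝ)+1))⁻¹ := by
    intro j; push_cast
    rw [show 2*(j:ℝ)+1+1 = 2*j+2 by ring]
  rw [tsum_congr e1, tsum_congr e2, h3]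
  push_cast
  rfl

lemma w_anti (N : ℕ) :
    ∑ p ∈ Finset.HasAntidiagonal.antidiagonal N, (2*(p.1:ℝ)+1)⁻¹ * (2*(p.2:ℝ)+2)⁻¹
      = (2*(N:ℝ)+3)⁻¹ * wH (2*N+2) := by
  have h : ∀ p ∈ Finset.HasAntidiagonal.antidiagonal N, (2*(p.1:ℝ)+1)⁻¹ * (2*(p.2:ℝ)+2)⁻¹
      = (2*(N:ℝ)+3)⁻¹ * ((2*(p.1:ℝ)+1)⁻¹ + (2*(p.2:ℝ)+2)⁻¹) := by
    rintro ⟨a, b⟩ hp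
    have : (N:ℝ) = a + b := by
      have := Finset.HasAntidiagonal.mem_antidiagonal.1 hp
      exact_mod_cast this.symm
    rw [this]
    have h1 : 2*(a:ℝ)+1 ≠ 0 := by positivity
    have h2 : 2*(b:ℝ)+2 ≠ 0 := by positivity
    have h3 : 2*((a:ℝ)+b)+3 ≠ 0 := by positivity
    simp only
    rw [inv_add_inv h1 h2]
    field_simp
    ring
  rw [Finset.sum_congr rfl h, ← Finset.mul_sum, Finset.sum_add_distrib]
  congr 1
  have e1 : ∑ p ∈ Finset.HasAntidiagonal.antidiagonal N, (2*(p.1:ℝ)+1)⁻¹ = ∑ i ∈ Finset.range (N+1), (2*(i:ℝ)+1)⁻¹ :=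
    Finset.Nat.sum_antidiagonal_eq_sum_range_succ (fun a _ => (2*(a:ℝ)+1)⁻¹) N
  have e2 : ∑ p ∈ Finset.HasAntidiagonal.antidiagonal N, (2*(p.2:ℝ)+2)⁻¹ = ∑ i ∈ Finset.range (N+1), (2*(i:ℝ)+2)⁻¹ := by
    rw [← Finset.Nat.sum_antidiagonal_swap]
    exact Finset.Nat.sum_antidiagonal_eq_sum_range_succ (fun a _ => (2*(a:ℝ)+2)⁻¹) N
  rw [e1, e2, ← Finset.sum_add_distrib]
  clear h e1 e2
  generalize hM : N+1 = M
  rw [show 2*N+2 = 2*M by omega]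
  clear hM N
  induction M with
  | zero => simp [wH]
  | succ n ih =>
    rw [Finset.sum_range_succ, ih, show 2*(n+1) = 2*n+1+1 by ring, wH_succ, wH_succ]
    push_cast
    ring

/-- the three summabilities -/
lemma w_sum1 (c q : ℕ) (e : ℕ → ℝ) (he : ∀ j : ℕ, (j:ℝ)+1 ≤ e j) :
    Summable (fun p : ℕ × ℕ => ((2*(p.1:ℝ)+1)⁻¹)^(q+1) * (((2*(p.1:ℝ)+1) + e p.2)⁻¹)^(c+1) * (e p.2)⁻¹) := by
  refine Summable.of_nonneg_of_le ?_ ?_ w_aux_summable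
  · rintro ⟨i, j⟩
    have : 0 < e j := lt_of_lt_of_le (by positivity) (he j)
    simp only
    positivity
  · rintro ⟨i, j⟩
    have h0 : 0 < e j := lt_of_lt_of_le (by positivity) (he j)
    refine le_trans ?_ (w_bound1 i j (2*(i:ℝ)+1) (e j) (by linarith [(Nat.cast_nonneg i : (0:ℝ) ≤ i)]) (he j))
    have h1 : ((2*(i:ℝ)+1)⁻¹)^(q+1) ≤ (2*(i:ℝ)+1)⁻¹ := by
      apply pow_le_of_le_one (by positivity) _ (by omega)
      apply inv_le_one_of_one_le₀; linarith [(Nat.cast_nonneg i : (0:ℝ) ≤ i)]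
    have h2 : (((2*(i:ℝ)+1) + e j)⁻¹)^(c+1) ≤ ((2*(i:ℝ)+1) + e j)⁻¹ := by
      apply pow_le_of_le_one (by positivity) _ (by omega)
      apply inv_le_one_of_one_le₀; linarith [(Nat.cast_nonneg i : (0:ℝ) ≤ i)]
    calc _ ≤ (2*(i:ℝ)+1)⁻¹ * ((2*(i:ℝ)+1) + e j)⁻¹ * (e j)⁻¹ := by
          simp only; gcongr
      _ = _ := by ring

lemma w_sum2 (c q : ℕ) (e : ℕ → ℝ) (he : ∀ j : ℕ, (j:ℝ)+1 ≤ e j) :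
    Summable (fun p : ℕ × ℕ => ((2*(p.1:ℝ)+1)⁻¹)^(q+1) * (((2*(p.1:ℝ)+1) + e p.2)⁻¹)^(c+2)) := by
  refine Summable.of_nonneg_of_le ?_ ?_ w_aux_summable
  · rintro ⟨i, j⟩
    have : 0 < e j := lt_of_lt_of_le (by positivity) (he j)
    simp only
    positivity
  · rintro ⟨i, j⟩
    have h0 : 0 < e j := lt_of_lt_of_le (by positivity) (he j)
    refine le_trans ?_ (w_bound2 i j (2*(i:ℝ)+1) (e j) (by linarith [(Nat.cast_nonneg i : (0:ℝ) ≤ i)]) (he j))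
    have h1 : ((2*(i:ℝ)+1)⁻¹)^(q+1) ≤ (2*(i:ℝ)+1)⁻¹ := by
      apply pow_le_of_le_one (by positivity) _ (by omega)
      apply inv_le_one_of_one_le₀; linarith [(Nat.cast_nonneg i : (0:ℝ) ≤ i)]
    have h2 : (((2*(i:ℝ)+1) + e j)⁻¹)^(c+2) ≤ ((2*(i:ℝ)+1) + e j)⁻¹^2 := by
      apply pow_le_pow_of_le_one (by positivity) _ (by omega)
      apply inv_le_one_of_one_le₀; linarith [(Nat.cast_nonneg i : (0:ℝ) ≤ i)]
    simp only; gcongr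

lemma w_sumT (s : ℕ) : Summable (fun i : ℕ => ((2*(i:ℝ)+1)⁻¹)^(s+2)) := by
  have h1 := (Real.summable_nat_pow_inv (p := s+2)).2 (by omega)
  have h2 := (summable_nat_add_iff 1).2 h1
  refine Summable.of_nonneg_of_le (fun i => by positivity) (fun i => ?_) h2
  rw [inv_pow]
  apply inv_anti₀ (by positivity)
  push_cast
  gcongr
  linarith [(Nat.cast_nonneg i : (0:ℝ) ≤ i)]

lemma w_o (j : ℕ) : (j:ℝ)+1 ≤ 2*(j:ℝ)+1 := by linarith [(Nat.cast_nonneg j : (0:ℝ) ≤ j)]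
lemma w_e (j : ℕ) : (j:ℝ)+1 ≤ 2*(j:ℝ)+2 := by linarith [(Nat.cast_nonneg j : (0:ℝ) ≤ j)]

def wA (q : ℕ) : ℝ := ∑' p : ℕ × ℕ,
  ((2*(p.1:ℝ)+1)⁻¹)^(q+1) * (((2*(p.1:ℝ)+1) + (2*(p.2:ℝ)+1))⁻¹)^(0+1) * (2*(p.2:ℝ)+1)⁻¹
def wD1 (q : ℕ) : ℝ := ∑' p : ℕ × ℕ,
  ((2*(p.1:ℝ)+1)⁻¹)^(q+1) * (((2*(p.1:ℝ)+1) + (2*(p.2:ℝ)+2))⁻¹)^(0+1) * (2*(p.2:ℝ)+2)⁻¹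
def wD2 (q : ℕ) : ℝ := ∑' p : ℕ × ℕ,
  ((2*(p.1:ℝ)+1)⁻¹)^(0+1) * (((2*(p.1:ℝ)+1) + (2*(p.2:ℝ)+2))⁻¹)^(q+1) * (2*(p.2:ℝ)+2)⁻¹

lemma w_AD1 (q : ℕ) : HasSum (fun i : ℕ => ((2*(i:ℝ)+1)⁻¹)^(q+2) * wH (2*i+1)) (wA q + wD1 q) := by
  have hA := w_sum1 0 q (fun j => 2*(j:ℝ)+1) w_o
  have hD := w_sum1 0 q (fun j => 2*(j:ℝ)+2) w_e
  have h1 := hA.prod.hasSum.add hD.prod.hasSum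
  rw [← hA.tsum_prod, ← hD.tsum_prod] at h1
  refine h1.congr_fun ?_
  intro i
  have := w_inner2 i
  rw [pow_succ, mul_assoc, ← this, mul_add, ← tsum_mul_left, ← tsum_mul_left]
  congr 1 <;> (apply tsum_congr; intro j; simp only; ring)

lemma w_D2 (q : ℕ) : HasSum (fun i : ℕ => ((2*(i:ℝ)+1)⁻¹)^(q+2) * wH (2*i)) (wD2 q) := by
  have hD := w_sum1 q 0 (fun j => 2*(j:ℝ)+2) w_e
  have h1 := (Finset.HasAntidiagonal.sigmaAntidiagonalEquivProd (A := ℕ)).hasSum_iff.2 hD.hasSum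
  have h2 := h1.sigma (fun N => hasSum_fintype _)
  have h3 : HasSum (fun N : ℕ => ((2*((N+1:ℕ):ℝ)+1)⁻¹)^(q+2) * wH (2*(N+1))) (wD2 q) := by
    refine h2.congr_fun ?_
    intro N
    have e := w_anti N
    simp only [Function.comp, Finset.HasAntidiagonal.sigmaAntidiagonalEquivProd_apply]
    rw [Finset.sum_coe_sort (Finset.HasAntidiagonal.antidiagonal N) (fun p : ℕ × ℕ =>
      ((2*(p.1:ℝ)+1)⁻¹)^(0+1) * (((2*(p.1:ℝ)+1) + (2*(p.2:ℝ)+2))⁻¹)^(q+1) * (2*(p.2:ℝ)+2)⁻¹)]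
    push_cast
    rw [show 2*((N:ℝ)+1)+1 = 2*N+3 by ring, show 2*(N+1) = 2*N+2 by ring, pow_succ, mul_assoc, ← e,
      Finset.mul_sum]
    apply Finset.sum_congr rfl
    rintro ⟨a, b⟩ hp
    have : (N:ℝ) = a + b := by
      have := Finset.HasAntidiagonal.mem_antidiagonal.1 hp
      exact_mod_cast this.symm
    rw [this]
    simp only
    rw [show 2*(a:ℝ)+1+(2*(b:ℝ)+2) = 2*((a:ℝ)+b)+3 by ring]
    ring
  have := (hasSum_nat_add_iff (f := fun i : ℕ => ((2*(i:ℝ)+1)⁻¹)^(q+2) * wH (2*i)) 1).1 h3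
  simpa [wH] using this

lemma w_key (q : ℕ) : wA q + wD1 q - wD2 q = ∑' i : ℕ, ((2*(i:ℝ)+1)⁻¹)^(q+3) := by
  rw [← ((w_AD1 q).sub (w_D2 q)).tsum_eq]
  apply tsum_congr
  intro i
  rw [wH_succ]
  push_cast
  ring

lemma w_Icc (q : ℕ) (f : ℕ → ℝ) :
    ∑ j ∈ Finset.Icc 2 (q+1), f j = ∑ t ∈ Finset.range q, f (t+2) := by
  rw [Finset.range_eq_Ico, Finset.sum_Ico_add' f 0 q 2]
  apply Finset.sum_congr _ (fun _ _ => rfl)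
  ext; simp; omega

lemma w_geomL (q : ℕ) (x o : ℝ) (hx : 0 < x) (ho : 0 < o) :
    ∑ t ∈ Finset.range (q+1), (x⁻¹)^(q-t+1) * ((x+o)⁻¹)^(t+2)
      = x⁻¹^(q+1) * (x+o)⁻¹^(0+1) * o⁻¹ - o⁻¹^(0+1) * (o+x)⁻¹^(q+2) := by
  have hg := (Commute.all ((x+o)⁻¹) (x⁻¹)).geom_sum₂_mul (q+1)
  have e : ∑ t ∈ Finset.range (q+1), (x⁻¹)^(q-t+1) * ((x+o)⁻¹)^(t+2)
      = x⁻¹ * (x+o)⁻¹^2 * ∑ t ∈ Finset.range (q+1), ((x+o)⁻¹)^t * (x⁻¹)^(q+1-1-t) := by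
    rw [Finset.mul_sum]
    apply Finset.sum_congr rfl
    intro t _
    rw [Nat.add_sub_cancel]
    ring
  rw [e, add_comm o x]
  have hb : (x+o)⁻¹ - x⁻¹ = - (o * (x⁻¹ * (x+o)⁻¹)) := by
    have : x + o ≠ 0 := by positivity
    field_simp; ring
  rw [hb] at hg
  generalize ∑ t ∈ Finset.range (q+1), ((x+o)⁻¹)^t * (x⁻¹)^(q+1-1-t) = S at *
  have h1 : S * (x⁻¹ * (x+o)⁻¹) = o⁻¹ * (x⁻¹^(q+1) - (x+o)⁻¹^(q+1)) := by
    rw [eq_inv_mul_iff_mul_eq₀ ho.ne']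
    linear_combination -hg
  linear_combination (x+o)⁻¹ * h1

lemma w_geomR (q : ℕ) (x o : ℝ) (hx : 0 < x) (ho : 0 < o) :
    ∑ t ∈ Finset.range q, (x⁻¹)^(t+2) * ((x+o)⁻¹)^(q-1-t+2)
      = x⁻¹^(q+1) * (x+o)⁻¹^(0+1) * o⁻¹ - x⁻¹^(0+1) * (x+o)⁻¹^(q+1) * o⁻¹ := by
  have hg := (Commute.all (x⁻¹) ((x+o)⁻¹)).geom_sum₂_mul q
  have e : ∑ t ∈ Finset.range q, (x⁻¹)^(t+2) * ((x+o)⁻¹)^(q-1-t+2)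
      = x⁻¹^2 * (x+o)⁻¹^2 * ∑ t ∈ Finset.range q, (x⁻¹)^t * ((x+o)⁻¹)^(q-1-t) := by
    rw [Finset.mul_sum]
    apply Finset.sum_congr rfl
    intro t _
    ring
  rw [e]
  have hb : x⁻¹ - (x+o)⁻¹ = o * (x⁻¹ * (x+o)⁻¹) := by
    have : x + o ≠ 0 := by positivity
    field_simp; ring
  rw [hb] at hg
  generalize ∑ t ∈ Finset.range q, (x⁻¹)^t * ((x+o)⁻¹)^(q-1-t) = S at *
  have h1 : S * (x⁻¹ * (x+o)⁻¹) = o⁻¹ * (x⁻¹^q - (x+o)⁻¹^q) := by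
    rw [← hg]
    field_simp
  linear_combination (x⁻¹ * (x+o)⁻¹) * h1

lemma w_left (q : ℕ) :
    2 * Tval ![1, q+2] + ∑ j ∈ Finset.Icc 2 (q+1), Tval ![q+3-j, j] = 4 * wA q := by
  have h1 : Tval ![1, q+2] + ∑ j ∈ Finset.Icc 2 (q+1), Tval ![q+3-j, j]
      = ∑ t ∈ Finset.range (q+1), Tval ![q-t+1, t+2] := by
    rw [w_Icc, Finset.sum_range_succ, add_comm, Nat.sub_self]
    congr 1
    apply Finset.sum_congr rfl
    intro t ht
    have := Finset.mem_range.1 ht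
    rw [show q+3-(t+2) = q-t+1 by omega]
  have hs := w_sum2 q 0 (fun j => 2*(j:ℝ)+1) w_o
  have hs' : Summable (fun p : ℕ × ℕ => ((2*(((Equiv.prodComm ℕ ℕ) p).1:ℝ)+1)⁻¹)^1 * (((2*(((Equiv.prodComm ℕ ℕ) p).1:ℝ)+1)+(2*(((Equiv.prodComm ℕ ℕ) p).2:ℝ)+1))⁻¹)^(q+2)) :=
    (Equiv.prodComm ℕ ℕ).summable_iff.2 hs
  have h2 : ∑ t ∈ Finset.range (q+1), Tval ![q-t+1, t+2] = 4 * wA q - Tval ![1, q+2] := by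
    simp_rw [w_Tval2]
    rw [← Finset.mul_sum, ← mul_sub]
    congr 1
    rw [← Summable.tsum_finsetSum (fun t _ => w_sum2 t (q-t) (fun j => 2*(j:ℝ)+1) w_o)]
    rw [← (Equiv.prodComm ℕ ℕ).tsum_eq (fun p : ℕ × ℕ => ((2*(p.1:ℝ)+1)⁻¹)^1 * (((2*(p.1:ℝ)+1)+(2*(p.2:ℝ)+1))⁻¹)^(q+2))]
    unfold wA
    rw [← Summable.tsum_sub (w_sum1 0 q (fun j => 2*(j:ℝ)+1) w_o) hs']
    apply tsum_congr
    rintro ⟨i, j⟩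
    exact w_geomL q (2*(i:ℝ)+1) (2*(j:ℝ)+1) (by positivity) (by positivity)
  linarith

lemma w_prod (s t : ℕ) : Tval ![s+2] * Tval ![t+2] =
    2 * Tval ![s+t+4]
      + 4 * ∑' p : ℕ × ℕ, ((2*(p.1:ℝ)+1)⁻¹)^(s+2) * (((2*(p.1:ℝ)+1) + (2*(p.2:ℝ)+2))⁻¹)^(t+2)
      + 4 * ∑' p : ℕ × ℕ, ((2*(p.1:ℝ)+1)⁻¹)^(t+2) * (((2*(p.1:ℝ)+1) + (2*(p.2:ℝ)+2))⁻¹)^(s+2) := by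
  have hs : Summable (fun p : ℕ × ℕ => ((2*(p.1:ℝ)+1)⁻¹)^(s+2) * ((2*(p.2:ℝ)+1)⁻¹)^(t+2)) :=
    (w_sumT s).mul_of_nonneg (w_sumT t) (fun i => by positivity) (fun i => by positivity)
  have h := (w_sumT s).tsum_mul_tsum (w_sumT t) hs
  rw [w_split _ hs] at h
  simp_rw [w_Tval1]
  have e1 : ∑' i : ℕ, ((2*(i:ℝ)+1)⁻¹)^(s+2) * ((2*(i:ℝ)+1)⁻¹)^(t+2)
      = ∑' i : ℕ, ((2*(i:ℝ)+1)⁻¹)^(s+t+4) := tsum_congr fun i => by ring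
  have e2 : ∑' p : ℕ × ℕ, ((2*(p.1:ℝ)+1)⁻¹)^(s+2) * ((2*((p.1+p.2+1:ℕ):ℝ)+1)⁻¹)^(t+2)
      = ∑' p : ℕ × ℕ, ((2*(p.1:ℝ)+1)⁻¹)^(s+2) * (((2*(p.1:ℝ)+1) + (2*(p.2:ℝ)+2))⁻¹)^(t+2) :=
    tsum_congr fun p => by
      rw [show 2*((p.1+p.2+1:ℕ):ℝ)+1 = (2*(p.1:ℝ)+1) + (2*(p.2:ℝ)+2) by push_cast; ring]
  have e3 : ∑' p : ℕ × ℕ, ((2*((p.1+p.2+1:ℕ):ℝ)+1)⁻¹)^(s+2) * ((2*(p.1:ℝ)+1)⁻¹)^(t+2)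
      = ∑' p : ℕ × ℕ, ((2*(p.1:ℝ)+1)⁻¹)^(t+2) * (((2*(p.1:ℝ)+1) + (2*(p.2:ℝ)+2))⁻¹)^(s+2) :=
    tsum_congr fun p => by
      rw [show 2*((p.1+p.2+1:ℕ):ℝ)+1 = (2*(p.1:ℝ)+1) + (2*(p.2:ℝ)+2) by push_cast; ring]
      ring
  simp only at h
  rw [e1, e2, e3] at h
  linear_combination 4 * h

lemma w_right (q : ℕ) :
    ∑ j ∈ Finset.Icc 2 (q+1), Tval ![j] * Tval ![q+3-j]
      = 2 * q * Tval ![q+3] + 8 * (wD1 q - wD2 q) := by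
  set B : ℕ → ℕ → ℝ := fun s t =>
    ∑' p : ℕ × ℕ, ((2*(p.1:ℝ)+1)⁻¹)^(s+2) * (((2*(p.1:ℝ)+1) + (2*(p.2:ℝ)+2))⁻¹)^(t+2) with hB
  have h1 : ∀ t ∈ Finset.range q, Tval ![t+2] * Tval ![q+3-(t+2)] =
      2 * Tval ![q+3] + 4 * B t (q-1-t) + 4 * B (q-1-t) t := by
    intro t ht
    have := Finset.mem_range.1 ht
    rw [show q+3-(t+2) = (q-1-t)+2 by omega, w_prod, show t+(q-1-t)+4 = q+3 by omega]
  have h2 : ∑ t ∈ Finset.range q, B (q-1-t) t = ∑ t ∈ Finset.range q, B t (q-1-t) := by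
    rw [← Finset.sum_range_reflect]
    apply Finset.sum_congr rfl
    intro t ht
    have := Finset.mem_range.1 ht
    rw [show q-1-(q-1-t) = t by omega]
  have h3 : ∑ t ∈ Finset.range q, B t (q-1-t) = wD1 q - wD2 q := by
    rw [hB, ← Summable.tsum_finsetSum (fun t _ => w_sum2 (q-1-t) (t+1) (fun j => 2*(j:ℝ)+2) w_e)]
    unfold wD1 wD2
    rw [← Summable.tsum_sub (w_sum1 0 q (fun j => 2*(j:ℝ)+2) w_e) (w_sum1 q 0 (fun j => 2*(j:ℝ)+2) w_e)]
    apply tsum_congr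
    rintro ⟨i, j⟩
    exact w_geomR q (2*(i:ℝ)+1) (2*(j:ℝ)+2) (by positivity) (by positivity)
  rw [w_Icc, Finset.sum_congr rfl h1, Finset.sum_add_distrib, Finset.sum_add_distrib,
    ← Finset.mul_sum, ← Finset.mul_sum, ← Finset.mul_sum, h2, h3]
  simp
  ring

/-- For `k ≥ 3`:
`−((1/2)T(1,k−1) + (1/4)Σ_{j=2}^{k−2} T(k−j,j))
  = −((k−1)/4)T(k) + (1/8)Σ_{j=2}^{k−2} T(j)T(k−j)`. -/
theorem weighted_depth_two_relation (k : ℕ) (hk : 3 ≤ k) :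
    -((1 / 2 : ℝ) * Tval ![1, k - 1]
        + (1 / 4) * ∑ j ∈ Finset.Icc 2 (k - 2), Tval ![k - j, j])
      = -(((k : ℝ) - 1) / 4) * Tval ![k]
        + (1 / 8) * ∑ j ∈ Finset.Icc 2 (k - 2), Tval ![j] * Tval ![k - j] := by
  obtain ⟨q, rfl⟩ : ∃ q, k = q + 3 := ⟨k - 3, by omega⟩
  have e1 : q + 3 - 1 = q + 2 := by omega
  have e2 : q + 3 - 2 = q + 1 := by omega
  rw [e1, e2, w_right]
  have hl := w_left q
  have hk := w_key q
  have ht := w_Tval1 (q+3)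
  rw [← hk] at ht
  push_cast
  rw [ht]
  linear_combination (-1/4) * hl

end
end

section
/- For every integer k ≥ 3, Σ_{j=2}^{k−1} 2^{j−1} T(k−j, j) = (k−1) T(k). -/
open Complex Filter Metric Finset

attribute [local instance] Classical.propDecidable

noncomputable section

lemma wsf_u : Summable (fun a : ℕ => 1 / (((a:ℝ)+1) * √((a:ℝ)+1))) := by
  have h := (Real.summable_nat_rpow_inv (p := 3/2)).2 (by norm_num)
  have h2 := (summable_nat_add_iff 1).2 h
  refine h2.congr fun a => ?_
  have hp : (0:ℝ) < (a:ℝ)+1 := by positivity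
  rw [one_div, Real.sqrt_eq_rpow]
  push_cast
  congr 1
  rw [← Real.rpow_one_add' hp.le (by norm_num)]
  norm_num

lemma wsf_v : Summable (fun d : ℤ => 1 / (|(d:ℝ)| * √|(d:ℝ)|)) := by
  have h : Summable (fun a : ℕ => 1 / ((a:ℝ) * √(a:ℝ))) := by
    rw [← summable_nat_add_iff 1]
    simpa using wsf_u
  refine Summable.of_nat_of_neg ?_ ?_
  · simpa using h
  · simpa using h

lemma wsf_uu : Summable (fun p : ℕ × ℕ =>
    1 / (((p.1:ℝ)+1) * √((p.1:ℝ)+1)) * (1 / (((p.2:ℝ)+1) * √((p.2:ℝ)+1)))) :=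
  wsf_u.mul_of_nonneg wsf_u (fun _ => by positivity) (fun _ => by positivity)

lemma wsf_uv : Summable (fun p : ℕ × ℕ =>
    1 / (((p.1:ℝ)+1) * √((p.1:ℝ)+1)) * (1 / (|(p.2:ℝ)-p.1| * √|(p.2:ℝ)-p.1|))) := by
  have h := wsf_u.mul_of_nonneg wsf_v (fun _ => by positivity) (fun _ => by positivity)
  have hi : Function.Injective (fun p : ℕ × ℕ => ((p.1, (p.2:ℤ) - p.1) : ℕ × ℤ)) := by
    rintro ⟨a, b⟩ ⟨c, d⟩ h
    simp only [Prod.mk.injEq] at h ⊢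
    omega
  refine (h.comp_injective hi).congr fun p => ?_
  simp

lemma wsf_sqrt {x p q : ℝ} (hp : 0 ≤ p) (h1 : p ≤ x) (h2 : q ≤ x) : √p * √q ≤ x := by
  have hx : 0 ≤ x := hp.trans h1
  calc √p * √q ≤ √x * √x := by gcongr
    _ = x := Real.mul_self_sqrt hx

/-- key bound -/
lemma wsf_bd (a b : ℕ) (y : ℝ) (hy : ((a:ℝ)+1) * ((a:ℝ)+1+b) ≤ y) :
    |1 / (y * ((b:ℝ)-a))| ≤
     1 / (((a:ℝ)+1) * √((a:ℝ)+1)) * (1 / (|(b:ℝ)-a| * √|(b:ℝ)-a|)) := by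
  have hy0 : 0 < y := lt_of_lt_of_le (by positivity) hy
  by_cases hab : (b:ℝ) - a = 0
  · simp [hab]
  have hd : 0 < |(b:ℝ)-a| := abs_pos.2 hab
  rw [abs_div, abs_mul, abs_one, abs_of_pos hy0, ← one_div_mul_one_div_rev, ← one_div_mul_one_div_rev]
  have ha : (0:ℝ) ≤ a := by positivity
  have hb : (0:ℝ) ≤ b := by positivity
  have h := wsf_sqrt (x := (a:ℝ)+1+b) (p := (a:ℝ)+1) (q := |(b:ℝ)-a|) (by positivity) (by linarith)
    (by rw [abs_le]; constructor <;> linarith)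
  have : 1 / y ≤ 1 / (((a:ℝ)+1) * (√((a:ℝ)+1) * √|(b:ℝ)-a|)) := by
    gcongr
    refine le_trans ?_ hy
    gcongr
  calc _ ≤ 1 / |(b:ℝ)-a| * (1 / (((a:ℝ)+1) * (√((a:ℝ)+1) * √|(b:ℝ)-a|))) := by gcongr
    _ = _ := by field_simp

lemma wsf_s1 (n : ℕ) (hn : 1 ≤ n) : Summable (fun p : ℕ × ℕ =>
    1 / (((2*(p.1:ℝ)+1)^n * ((p.1:ℝ)+1+p.2)) * ((p.2:ℝ)-p.1))) := by
  refine Summable.of_norm_bounded wsf_uv fun p => wsf_bd _ _ _ ?_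
  have ha : (0:ℝ) ≤ p.1 := by positivity
  gcongr
  calc (p.1:ℝ)+1 ≤ 2 * (p.1:ℝ)+1 := by linarith
    _ = (2 * (p.1:ℝ)+1)^1 := by ring
    _ ≤ _ := pow_le_pow_right₀ (by linarith) hn

lemma wsf_s2 (n : ℕ) (hn : 1 ≤ n) : Summable (fun p : ℕ × ℕ =>
    1 / ((((p.1:ℝ)+1+p.2)^(n+1)) * ((p.2:ℝ)-p.1))) := by
  refine Summable.of_norm_bounded wsf_uv fun p => wsf_bd _ _ _ ?_
  have ha : (0:ℝ) ≤ p.1 := by positivity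
  have hb : (0:ℝ) ≤ p.2 := by positivity
  rw [pow_succ]
  gcongr
  calc (p.1:ℝ)+1 ≤ (p.1:ℝ)+1+p.2 := by linarith
    _ = ((p.1:ℝ)+1+p.2)^1 := by ring
    _ ≤ _ := pow_le_pow_right₀ (by linarith) hn

lemma wsf_s3 (r s : ℕ) (hr : 1 ≤ r) (hs : 2 ≤ s) : Summable (fun p : ℕ × ℕ =>
    1 / ((2*(p.1:ℝ)+1)^r * ((p.1:ℝ)+1+p.2)^s)) := by
  refine Summable.of_nonneg_of_le (fun p => by positivity) (fun p => ?_) wsf_uu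
  have ha : (0:ℝ) ≤ p.1 := by positivity
  have hb : (0:ℝ) ≤ p.2 := by positivity
  rw [one_div_mul_one_div]
  have h := wsf_sqrt (x := (p.1:ℝ)+1+p.2) (p := (p.1:ℝ)+1) (q := (p.2:ℝ)+1) (by positivity)
    (by linarith) (by linarith)
  apply one_div_le_one_div_of_le (by positivity)
  calc _ = ((p.1:ℝ)+1) * (((p.2:ℝ)+1) * (√((p.1:ℝ)+1) * √((p.2:ℝ)+1))) := by ring
    _ ≤ (2*(p.1:ℝ)+1) * (((p.1:ℝ)+1+p.2) * ((p.1:ℝ)+1+p.2)) := by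
      have h1 : (p.1:ℝ)+1 ≤ 2*(p.1:ℝ)+1 := by linarith
      have h2 : (p.2:ℝ)+1 ≤ (p.1:ℝ)+1+p.2 := by linarith
      exact mul_le_mul h1 (mul_le_mul h2 h (by positivity) (by positivity)) (by positivity) (by positivity)
    _ = (2*(p.1:ℝ)+1)^1 * ((p.1:ℝ)+1+p.2)^2 := by ring
    _ ≤ _ := by
      gcongr <;> linarith

lemma wsf_anti (n : ℕ) : ∑' p : ℕ × ℕ, 1 / ((((p.1:ℝ)+1+p.2)^(n+1)) * ((p.2:ℝ)-p.1)) = 0 := by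
  have h := (Equiv.prodComm ℕ ℕ).tsum_eq
    (fun p : ℕ × ℕ => 1 / ((((p.1:ℝ)+1+p.2)^(n+1)) * ((p.2:ℝ)-p.1)))
  have h2 : ∀ p : ℕ × ℕ, (fun p : ℕ × ℕ => 1 / ((((p.1:ℝ)+1+p.2)^(n+1)) * ((p.2:ℝ)-p.1)))
      (Equiv.prodComm ℕ ℕ p) = - (1 / ((((p.1:ℝ)+1+p.2)^(n+1)) * ((p.2:ℝ)-p.1))) := by
    intro p
    simp only [Equiv.prodComm_apply, Prod.fst_swap, Prod.snd_swap]
    rw [show (p.1:ℝ) - p.2 = -(p.2 - p.1) by ring, mul_neg, div_neg,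
      show (p.2:ℝ)+1+p.1 = p.1+1+p.2 by ring]
  rw [tsum_congr h2, tsum_neg] at h
  linarith

lemma wsf_refl (a : ℕ) : ∑ b ∈ Finset.range (2*a+1), 1 / ((b:ℝ)-a) = 0 := by
  have h := Finset.sum_range_reflect (fun b : ℕ => 1 / ((b:ℝ)-a)) (2*a+1)
  have h2 : ∀ b ∈ Finset.range (2*a+1), 1 / (((2*a+1-1-b : ℕ):ℝ)-a) = -(1/((b:ℝ)-a)) := by
    intro b hb
    rw [Finset.mem_range] at hb
    rw [Nat.cast_sub (by omega)]
    push_cast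
    rw [← div_neg]
    congr 1
    simp
    ring
  rw [Finset.sum_congr rfl h2, Finset.sum_neg_distrib] at h
  linarith

lemma wsf_part (a c : ℕ) : ∑ b ∈ Finset.range (2*a+1+c), 1 / (((a:ℝ)+1+b) * ((b:ℝ)-a)) =
    1/(2*(a:ℝ)+1) * (1/(2*(a:ℝ)+1) - ∑ i ∈ Finset.range (2*a+1), 1 / ((a:ℝ)+1+c+i)) := by
  have h1 : ∀ b ∈ Finset.range (2*a+1+c), 1 / (((a:ℝ)+1+b) * ((b:ℝ)-a)) =
      1/(2*(a:ℝ)+1) * (1 / ((b:ℝ)-a) - 1/((a:ℝ)+1+b) + if b = a then 1/(2*(a:ℝ)+1) else 0) := by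
    intro b _
    have h0 : (a:ℝ)+1+b ≠ 0 := by positivity
    have h0' : 2*(a:ℝ)+1 ≠ 0 := by positivity
    split_ifs with h
    · subst h
      simp
      right
      rw [show (b:ℝ)+1+b = 2*b+1 by ring]
      ring
    · have : (b:ℝ) - a ≠ 0 := sub_ne_zero.2 (by exact_mod_cast h)
      field_simp
      ring
  rw [Finset.sum_congr rfl h1, ← Finset.mul_sum, Finset.sum_add_distrib, Finset.sum_sub_distrib,
    Finset.sum_ite_eq' , if_pos (by simp; omega)]
  rw [Finset.sum_range_add, wsf_refl]
  rw [show 2*a+1+c = c + (2*a+1) by ring, Finset.sum_range_add]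
  have e1 : ∀ x ∈ Finset.range c, 1 / (((2*a+1+x : ℕ):ℝ) - a) = 1/((a:ℝ)+1+x) := by
    intro x _
    push_cast
    congr 1
    ring
  have e2 : ∀ x ∈ Finset.range (2*a+1), 1 / ((a:ℝ)+1+((c+x : ℕ):ℝ)) = 1/((a:ℝ)+1+c+x) := by
    intro x _
    push_cast
    congr 1
    ring
  rw [Finset.sum_congr rfl e1, Finset.sum_congr rfl e2]
  ring

lemma wsf_inner (a : ℕ) (hs : Summable (fun b : ℕ => 1 / (((a:ℝ)+1+b) * ((b:ℝ)-a)))) :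
    ∑' b : ℕ, 1 / (((a:ℝ)+1+b) * ((b:ℝ)-a)) = 1/(2*(a:ℝ)+1)^2 := by
  have h := hs.hasSum.tendsto_sum_nat
  have h1 : Tendsto (fun c : ℕ => 2*a+1+c) atTop atTop := tendsto_atTop_mono (fun c => by simp only [id]; omega) tendsto_id
  have h2 := h.comp h1
  refine tendsto_nhds_unique h2 ?_
  have h3 : ∀ c, ((fun n => ∑ i ∈ range n, 1 / ((↑a + 1 + ↑i) * ((i:ℝ) - ↑a))) ∘ fun c => 2 * a + 1 + c) c = _ := fun c => wsf_part a c
  rw [funext h3]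
  have h4 : Tendsto (fun c : ℕ => ∑ i ∈ Finset.range (2*a+1), 1 / ((a:ℝ)+1+c+i)) atTop (nhds (∑ i ∈ Finset.range (2*a+1), 0)) := by
    refine tendsto_finsetSum _ fun i _ => ?_
    refine squeeze_zero (fun c => by positivity) (fun c => ?_) (tendsto_one_div_add_atTop_nhds_zero_nat (𝕜 := ℝ))
    apply one_div_le_one_div_of_le (by positivity)
    have : (0:ℝ) ≤ a := by positivity
    have : (0:ℝ) ≤ i := by positivity
    linarith
  have h5 := (h4.const_sub (1/(2*(a:ℝ)+1))).const_mul (1/(2*(a:ℝ)+1))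
  convert h5 using 2
  rw [Finset.sum_const_zero, sub_zero, one_div_mul_one_div, pow_two]

lemma wsf_first (n : ℕ) (hn : 1 ≤ n) : ∑' p : ℕ × ℕ,
    1 / (((2*(p.1:ℝ)+1)^n * ((p.1:ℝ)+1+p.2)) * ((p.2:ℝ)-p.1)) = ∑' a : ℕ, 1/(2*(a:ℝ)+1)^(n+2) := by
  rw [(wsf_s1 n hn).tsum_prod]
  refine tsum_congr fun a => ?_
  have h0 : (2*(a:ℝ)+1)^n ≠ 0 := by positivity
  have e : ∀ b : ℕ, 1 / (((2*(a:ℝ)+1)^n * ((a:ℝ)+1+b)) * ((b:ℝ)-a)) =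
      1/(2*(a:ℝ)+1)^n * (1 / (((a:ℝ)+1+b) * ((b:ℝ)-a))) := by
    intro b
    rw [one_div_mul_one_div, mul_assoc]
  have hs : Summable (fun b : ℕ => 1 / (((a:ℝ)+1+b) * ((b:ℝ)-a))) := by
    have := (wsf_s1 n hn).prod_factor a
    simp only [e] at this
    exact (summable_mul_left_iff (by positivity)).1 this
  simp only [e]
  rw [tsum_mul_left, wsf_inner a hs, one_div_mul_one_div, pow_add]

lemma wsf_geo (m N : ℝ) (hm : m ≠ 0) (hN : N ≠ 0) (h : N ≠ m) (n : ℕ) :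
    ∑ i ∈ Finset.range n, 1 / (m^(n-i) * N^(i+2)) =
      1 / (m^n * N * (N - m)) - 1 / (N^(n+1) * (N-m)) := by
  have h' : N - m ≠ 0 := sub_ne_zero.2 h
  induction n with
  | zero => simp
  | succ n ih =>
    rw [Finset.sum_range_succ]
    have : ∀ i ∈ Finset.range n, 1 / (m^(n+1-i) * N^(i+2)) = 1/m * (1 / (m^(n-i) * N^(i+2))) := by
      intro i hi
      rw [Finset.mem_range] at hi
      rw [Nat.succ_sub hi.le, pow_succ, one_div_mul_one_div]
      congr 1
      ring
    rw [Finset.sum_congr rfl this, ← Finset.mul_sum, ih]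
    simp only [Nat.add_sub_cancel_left]
    field_simp
    ring

lemma wsf_point (n a b : ℕ) :
    ∑ i ∈ Finset.range n, 1 / ((2*(a:ℝ)+1)^(n-i) * ((a:ℝ)+1+b)^(i+2)) =
      (1 / (((2*(a:ℝ)+1)^n * ((a:ℝ)+1+b)) * ((b:ℝ)-a)) - 1 / ((((a:ℝ)+1+b)^(n+1)) * ((b:ℝ)-a)))
       + if a = b then n * (1 / (2*(a:ℝ)+1)^(n+2)) else 0 := by
  split_ifs with h
  · subst h
    simp only [sub_self, mul_zero, div_zero, zero_add]
    have : ∀ i ∈ Finset.range n, 1 / ((2*(a:ℝ)+1)^(n-i) * ((a:ℝ)+1+a)^(i+2)) = 1 / (2*(a:ℝ)+1)^(n+2) := by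
      intro i hi
      rw [Finset.mem_range] at hi
      rw [show (a:ℝ)+1+a = 2*a+1 by ring, ← pow_add]
      congr 2
      omega
    rw [Finset.sum_congr rfl this]
    simp
  · rw [add_zero, wsf_geo _ _ (by positivity) (by positivity)]
    · rw [show (a:ℝ)+1+b - (2*a+1) = b - a by ring]
    · intro h'
      apply h
      have : (b:ℝ) = a := by linarith
      exact_mod_cast this.symm

lemma wsf_odd (n : ℕ) : Summable (fun a : ℕ => 1/(2*(a:ℝ)+1)^(n+2)) := by
  refine Summable.of_nonneg_of_le (fun p => by positivity) (fun p => ?_) wsf_u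
  apply one_div_le_one_div_of_le (by positivity)
  have hp : (0:ℝ) ≤ p := by positivity
  calc ((p:ℝ)+1) * √((p:ℝ)+1) ≤ ((p:ℝ)+1) * ((p:ℝ)+1) := by
        gcongr
        rw [Real.sqrt_le_left (by positivity)]
        nlinarith
    _ ≤ (2*(p:ℝ)+1)^2 := by nlinarith
    _ ≤ _ := pow_le_pow_right₀ (by linarith) (by omega)

lemma wsf_diag (f : ℕ → ℝ) (hf : Summable f) :
    HasSum (fun p : ℕ × ℕ => if p.1 = p.2 then f p.1 else 0) (∑' a, f a) := by
  have hi : Function.Injective (fun a : ℕ => (a, a)) := fun a b h => (Prod.mk.inj h).1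
  rw [← hi.hasSum_iff]
  · simpa [Function.comp_def] using hf.hasSum
  · rintro ⟨a, b⟩ h
    simp only
    rw [if_neg]
    rintro rfl
    exact h ⟨a, rfl⟩

lemma wsf_core (n : ℕ) (hn : 1 ≤ n) :
    ∑ i ∈ Finset.range n, ∑' p : ℕ × ℕ, 1 / ((2*(p.1:ℝ)+1)^(n-i) * ((p.1:ℝ)+1+p.2)^(i+2)) =
      (n + 1) * ∑' a : ℕ, 1/(2*(a:ℝ)+1)^(n+2) := by
  rw [← Summable.tsum_finsetSum]
  · simp only [wsf_point]
    have hd := wsf_diag (fun a => n * (1 / (2*(a:ℝ)+1)^(n+2))) ((wsf_odd n).mul_left _)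
    rw [Summable.tsum_add ((wsf_s1 n hn).sub (wsf_s2 n hn)) hd.summable,
      Summable.tsum_sub (wsf_s1 n hn) (wsf_s2 n hn), wsf_anti, wsf_first n hn, hd.tsum_eq, tsum_mul_left]
    ring
  · intro i hi
    rw [Finset.mem_range] at hi
    exact wsf_s3 _ _ (by omega) (by omega)

lemma wsf_T1 (k : ℕ) : Tval ![k] = 2 * ∑' a : ℕ, 1/(2*(a:ℝ)+1)^k := by
  unfold Tval
  rw [pow_one]
  congr 1
  have hi : Function.Injective (fun a : ℕ => (![2*a+1] : Fin 1 → ℕ)) := by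
    intro a b h
    have := congrFun h 0
    simp at this
    exact this
  rw [← hi.tsum_eq]
  · refine tsum_congr fun a => ?_
    rw [if_pos]
    · simp
    · refine ⟨Subsingleton.strictMono _, fun i => ?_⟩
      fin_cases i
      simp
  · intro m hm
    rw [Function.mem_support, ne_eq, ite_eq_right_iff, Classical.not_imp] at hm
    have h := hm.1.2 0
    simp at h
    refine ⟨m 0 / 2, ?_⟩
    ext i
    fin_cases i
    simp
    omega

lemma wsf_T2 (r s : ℕ) : Tval ![r, s] = 4 * ∑' p : ℕ × ℕ,
    1/((2*(p.1:ℝ)+1)^r * (2*((p.1:ℝ)+1+p.2))^s) := by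
  unfold Tval
  rw [show (2:ℝ)^2 = 4 by norm_num]
  congr 1
  have hi : Function.Injective (fun p : ℕ × ℕ => (![2*p.1+1, 2*(p.1+1+p.2)] : Fin 2 → ℕ)) := by
    rintro ⟨a, b⟩ ⟨c, d⟩ h
    have h0 := congrFun h 0
    have h1 := congrFun h 1
    simp at h0 h1
    ext <;> simp <;> omega
  rw [← hi.tsum_eq]
  · refine tsum_congr fun a => ?_
    rw [if_pos]
    · simp [Fin.prod_univ_two]
    · refine ⟨?_, fun i => ?_⟩
      · rw [Fin.strictMono_iff_lt_succ]
        intro i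
        fin_cases i
        simp
        try omega
      · fin_cases i <;> simp
  · intro m hm
    rw [Function.mem_support, ne_eq, ite_eq_right_iff, Classical.not_imp] at hm
    have h := hm.1.2 0
    have h' := hm.1.2 1
    have h'' : m 0 < m 1 := hm.1.1 (by simp)
    simp at h h'
    refine ⟨(m 0 / 2, m 1 / 2 - m 0 / 2 - 1), ?_⟩
    ext i
    fin_cases i <;> simp <;> omega

/-- Kaneko–Tsumura weighted sum formula: for `k ≥ 3`,
`Σ_{j=2}^{k−1} 2^{j−1} T(k−j, j) = (k−1) T(k)`. -/
theorem weighted_sum_formula (k : ℕ) (hk : 3 ≤ k) :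
    ∑ j ∈ Finset.Icc 2 (k - 1), (2 : ℝ) ^ (j - 1) * Tval ![k - j, j]
      = ((k : ℝ) - 1) * Tval ![k] := by
  obtain ⟨n, rfl⟩ : ∃ n, k = n + 2 := ⟨k - 2, by omega⟩
  have e : Finset.Icc 2 (n + 2 - 1) = Finset.Ico 2 (n+2) := by
    ext x
    simp only [Finset.mem_Icc, Finset.mem_Ico]
    omega
  rw [e, Finset.sum_Ico_eq_sum_range, wsf_T1]
  simp only [Nat.add_sub_cancel]
  have h := wsf_core n (by omega)
  have e2 : ∀ i ∈ Finset.range n, (2 : ℝ) ^ (2 + i - 1) * Tval ![n + 2 - (2 + i), 2 + i] =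
      2 * ∑' p : ℕ × ℕ, 1 / ((2*(p.1:ℝ)+1)^(n-i) * ((p.1:ℝ)+1+p.2)^(i+2)) := by
    intro i _
    rw [wsf_T2, show 2 + i - 1 = i + 1 by omega, show n + 2 - (2 + i) = n - i by omega,
      show 2 + i = i + 2 by omega, ← mul_assoc, ← tsum_mul_left, ← tsum_mul_left]
    refine tsum_congr fun p => ?_
    rw [mul_pow]
    have h1 : (2*(p.1:ℝ)+1)^(n-i) ≠ 0 := by positivity
    have h2 : ((p.1:ℝ)+1+p.2)^(i+2) ≠ 0 := by positivity
    field_simp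
    ring
  rw [Finset.sum_congr rfl e2, ← Finset.mul_sum, h]
  push_cast
  ring

end
end

section
/- For all integers k, n ≥ 1, s ≥ 1 and complex t with 0 < |t| < 1, d/dt G₀(k, n, s; t) = (1/t) ( G₀(k−1, n, s; t) + G(k−1, n, s−1; t) − G₀(k−1, n, s−1; t) ). Moreover, for all integers k, n ≥ 1, s ≥ 0 and |t| < 1, d/dt ( G(k, n, s; t) − G₀(k, n, s; t) ) = (2/(1−t²)) G(k−1, n−1, s; t), where by convention G(k, 0, s; t) = 1 if (k,s) = (0,0) and G(k, 0, s; t) = 0 otherwise. -/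
open Complex Filter Metric Finset

attribute [local instance] Classical.propDecidable

noncomputable section

def sn {N : ℕ} (m : Fin N → ℕ) (a : ℕ) : Fin (N + 1) → ℕ :=
  Fin.snoc (α := fun _ => ℕ) m a

lemma sn_castSucc {N : ℕ} (m : Fin N → ℕ) (a : ℕ) (i : Fin N) : sn m a i.castSucc = m i := by
  simp [sn]

lemma sn_last {N : ℕ} (m : Fin N → ℕ) (a : ℕ) : sn m a (Fin.last N) = a := by
  simp [sn]

lemma sn_init {N : ℕ} (q : Fin (N + 1) → ℕ) :
    sn (fun i => q i.castSucc) (q (Fin.last N)) = q := by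
  funext j
  induction j using Fin.lastCases with
  | last => rw [sn_last]
  | cast i => rw [sn_castSucc]

lemma sn_inj {N : ℕ} {m m' : Fin N → ℕ} {a a' : ℕ} (h : sn m a = sn m' a') : m = m' ∧ a = a' := by
  constructor
  · funext i
    have := congrFun h i.castSucc
    simpa only [sn_castSucc] using this
  · have := congrFun h (Fin.last N)
    simpa only [sn_last] using this

lemma lastExp_succ {N : ℕ} (m : Fin (N + 1) → ℕ) : lastExp m = m (Fin.last N) := by
  simp [lastExp]; rfl

lemma lastExp_zero (m : Fin 0 → ℕ) : lastExp m = 0 := by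
  simp [lastExp]

lemma le_lastExp {N : ℕ} {m : Fin N → ℕ} (h : athCond N m) (i : Fin N) : m i ≤ lastExp m := by
  cases N with
  | zero => exact i.elim0
  | succ N =>
    rw [lastExp_succ]
    exact h.1.monotone (Fin.le_last i)

lemma lastExp_mod {N : ℕ} {m : Fin N → ℕ} (h : athCond N m) : lastExp m % 2 = N % 2 := by
  cases N with
  | zero => rw [lastExp_zero]
  | succ N =>
    rw [lastExp_succ, (h.2 (Fin.last N)).1]; simp

lemma athCond_sn {N : ℕ} (m : Fin N → ℕ) (a : ℕ) :
    athCond (N + 1) (sn m a) ↔ athCond N m ∧ lastExp m < a ∧ a % 2 = (N + 1) % 2 := by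
  constructor
  · rintro ⟨h1, h2⟩
    refine ⟨⟨?_, ?_⟩, ?_, ?_⟩
    · intro i j hij
      have := h1 (Fin.castSucc_lt_castSucc_iff.2 hij)
      simpa only [sn_castSucc] using this
    · intro i
      have := h2 i.castSucc
      simpa only [sn_castSucc, Fin.val_castSucc] using this
    · cases N with
      | zero =>
        rw [lastExp_zero]
        have := (h2 (Fin.last 0)).2
        simpa only [sn_last] using this
      | succ N =>
        rw [lastExp_succ]
        have := h1 (Fin.castSucc_lt_last (Fin.last N))
        simpa only [sn_last, sn_castSucc] using this
    · have := (h2 (Fin.last N)).1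
      simpa only [sn_last, Fin.val_last] using this
  · rintro ⟨h, h1, h2⟩
    refine ⟨?_, ?_⟩
    · intro i j hij
      induction j using Fin.lastCases with
      | last =>
        induction i using Fin.lastCases with
        | last => exact absurd hij (lt_irrefl _)
        | cast i =>
          rw [sn_last, sn_castSucc]
          exact (le_lastExp h i).trans_lt h1
      | cast j =>
        induction i using Fin.lastCases with
        | last => exact absurd hij (not_lt.2 (Fin.le_last _))
        | cast i =>
          rw [sn_castSucc, sn_castSucc]
          exact h.1 (Fin.castSucc_lt_castSucc_iff.1 hij)
    · intro i
      induction i using Fin.lastCases with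
      | last => rw [sn_last]; exact ⟨h2, by omega⟩
      | cast i => rw [sn_castSucc]; exact h.2 i

lemma summable_prod_pow (N : ℕ) {r : ℝ} (h0 : 0 ≤ r) (h1 : r < 1) :
    Summable (fun m : Fin N → ℕ => ∏ i, r ^ m i) := by
  induction N with
  | zero => exact Summable.of_finite
  | succ N ih =>
    have := Summable.mul_of_nonneg (summable_geometric_of_lt_one h0 h1) ih
      (fun i => by positivity) (fun m => Finset.prod_nonneg fun i _ => by positivity)
    rw [← (Fin.consEquiv (fun _ : Fin (N + 1) => ℕ)).summable_iff]
    refine this.congr ?_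
    rintro ⟨a, m⟩
    simp [Fin.consEquiv, Fin.prod_univ_succ]

lemma summable_ath (N : ℕ) {r : ℝ} (h0 : 0 ≤ r) (h1 : r < 1) :
    Summable (fun m : Fin N → ℕ => if athCond N m then r ^ lastExp m else 0) := by
  rcases Nat.eq_zero_or_pos N with rfl | hN
  · exact Summable.of_finite
  set q : ℝ := r ^ ((N : ℝ)⁻¹) with hq
  have hq0 : 0 ≤ q := Real.rpow_nonneg h0 _
  have hqN : q ^ N = r := Real.rpow_inv_natCast_pow h0 hN.ne'
  have hq1 : q < 1 := Real.rpow_lt_one h0 h1 (by positivity)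
  refine Summable.of_nonneg_of_le (fun m => ?_) (fun m => ?_) (summable_prod_pow N hq0 hq1)
  · split_ifs <;> positivity
  · split_ifs with h
    · rw [← hqN, ← pow_mul, Finset.prod_pow_eq_pow_sum]
      refine pow_le_pow_of_le_one hq0 hq1.le ?_
      calc ∑ i, m i ≤ ∑ i : Fin N, lastExp m := Finset.sum_le_sum fun i _ => le_lastExp h i
        _ = N * lastExp m := by simp
    · exact Finset.prod_nonneg fun i _ => by positivity

lemma ath_term_le {N : ℕ} (κ m : Fin N → ℕ) {w : ℂ} {r : ℝ} (hw : ‖w‖ ≤ r) :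
    ‖(if athCond N m then w ^ lastExp m / ∏ i, ((m i : ℂ) ^ κ i) else 0)‖ ≤
      if athCond N m then r ^ lastExp m else 0 := by
  split_ifs with h
  · rw [norm_div, norm_pow, norm_prod]
    have h1 : (1 : ℝ) ≤ ∏ i, ‖((m i : ℂ) ^ κ i)‖ := by
      rw [← Finset.prod_const_one (s := (Finset.univ : Finset (Fin N)))]
      refine Finset.prod_le_prod (fun _ _ => zero_le_one) ?_
      intro i _
      rw [norm_pow, Complex.norm_natCast]
      exact one_le_pow₀ (by exact_mod_cast (h.2 i).2)
    have h2 : ‖w‖ ^ lastExp m ≤ r ^ lastExp m := by gcongr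
    exact (div_le_self (by positivity) h1).trans h2
  · simp

lemma ath_hasDerivAt {N : ℕ} (κ : Fin N → ℕ) {t : ℂ} (ht : ‖t‖ < 1) :
    HasDerivAt (Ath κ) (∑' m : Fin N → ℕ, if athCond N m then
      (lastExp m : ℂ) * t ^ (lastExp m - 1) / ∏ i, ((m i : ℂ) ^ κ i) else 0) t := by
  obtain ⟨r, hr, hr1⟩ := exists_between ht
  have hr0 : 0 ≤ r := (norm_nonneg t).trans hr.le
  set F : (Fin N → ℕ) → ℂ → ℂ := fun m w =>
    if athCond N m then w ^ lastExp m / ∏ i, ((m i : ℂ) ^ κ i) else 0 with hF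
  have hd : ∀ m w, HasDerivAt (F m) (if athCond N m then
      (lastExp m : ℂ) * w ^ (lastExp m - 1) / ∏ i, ((m i : ℂ) ^ κ i) else 0) w := by
    intro m w
    simp only [hF]
    split_ifs with h
    · exact (hasDerivAt_pow _ w).div_const _
    · exact hasDerivAt_const _ _
  have hU : IsOpen (ball (0 : ℂ) r) := isOpen_ball
  have htU : t ∈ ball (0 : ℂ) r := by simpa using hr
  have hdo : ∀ m, DifferentiableOn ℂ (F m) (ball (0 : ℂ) r) :=
    fun m w _ => (hd m w).differentiableAt.differentiableWithinAt
  have hle : ∀ m w, w ∈ ball (0 : ℂ) r → ‖F m w‖ ≤ if athCond N m then r ^ lastExp m else 0 :=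
    fun m w hw => ath_term_le κ m (by simpa using (mem_ball_zero_iff.1 hw).le)
  have h1 := Complex.differentiableOn_tsum_of_summable_norm (summable_ath N hr0 hr1) hdo hU hle
  have h2 := Complex.hasSum_deriv_of_summable_norm (summable_ath N hr0 hr1) hdo hU hle htU
  have h3 := (h1.differentiableAt (hU.mem_nhds htU)).hasDerivAt
  rw [← h2.tsum_eq] at h3
  have h4 : ∀ m, deriv (F m) t = _ := fun m => (hd m t).deriv
  simp only [h4] at h3
  exact h3

lemma ath_deriv_inc {N : ℕ} (p : Fin N → ℕ) (a : ℕ) {t : ℂ} (h0 : t ≠ 0) (ht : ‖t‖ < 1) :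
    HasDerivAt (Ath (sn p (a + 1))) (1 / t * Ath (sn p a) t) t := by
  refine (ath_hasDerivAt _ ht).congr_deriv ?_
  rw [Ath, ← tsum_mul_left]
  refine tsum_congr fun m => ?_
  split_ifs with h
  · have hp : 0 < lastExp m := by rw [lastExp_succ]; exact (h.2 _).2
    have hm : ∀ i, (m i : ℂ) ≠ 0 := fun i => by exact_mod_cast (h.2 i).2.ne'
    simp only [Fin.prod_univ_castSucc, sn_castSucc, sn_last]
    have hA : ∏ i : Fin N, (m i.castSucc : ℂ) ^ p i ≠ 0 :=
      Finset.prod_ne_zero_iff.2 fun i _ => pow_ne_zero _ (hm _)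
    rw [← lastExp_succ m]
    have hL : (lastExp m : ℂ) ≠ 0 := by exact_mod_cast hp.ne'
    obtain ⟨l, hl⟩ : ∃ l, lastExp m = l + 1 := ⟨lastExp m - 1, by omega⟩
    rw [hl] at hL ⊢
    rw [Nat.add_sub_cancel, pow_succ t l, pow_succ _ a]
    field_simp
  · simp

lemma ath_deriv_one {N : ℕ} (p : Fin N → ℕ) {t : ℂ} (ht : ‖t‖ < 1) :
    HasDerivAt (Ath (sn p 1)) (1 / (1 - t ^ 2) * Ath p t) t := by
  refine (ath_hasDerivAt _ ht).congr_deriv ?_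
  have ht2 : ‖t ^ 2‖ < 1 := by
    rw [norm_pow]; exact pow_lt_one₀ (norm_nonneg _) ht (by norm_num)
  have hs : Summable fun m : Fin N → ℕ =>
      ‖(if athCond N m then t ^ lastExp m / ∏ i, ((m i : ℂ) ^ p i) else 0)‖ :=
    Summable.of_nonneg_of_le (fun _ => norm_nonneg _) (fun m => ath_term_le p m le_rfl)
      (summable_ath N (norm_nonneg t) ht)
  have hg : Summable fun j : ℕ => ‖(t ^ 2) ^ j‖ := by
    simpa only [norm_pow] using summable_geometric_of_lt_one (norm_nonneg _) ht2
  rw [one_div, ← tsum_geometric_of_norm_lt_one ht2, mul_comm, Ath,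
    tsum_mul_tsum_of_summable_norm hs hg]
  set g : (Fin N → ℕ) × ℕ → (Fin (N + 1) → ℕ) := fun z => sn z.1 (lastExp z.1 + 2 * z.2 + 1)
    with hgd
  have hinj : Function.Injective g := by
    rintro ⟨m, j⟩ ⟨m', j'⟩ h
    obtain ⟨h1, h2⟩ := sn_inj h
    simp only at h1 h2
    subst h1
    have : j = j' := by omega
    rw [this]
  rw [← hinj.tsum_eq]
  · refine tsum_congr ?_
    rintro ⟨m, j⟩
    simp only [hgd, athCond_sn]
    by_cases h : athCond N m
    · have hm := lastExp_mod h
      have hc : lastExp m < lastExp m + 2 * j + 1 ∧ (lastExp m + 2 * j + 1) % 2 = (N + 1) % 2 := by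
        omega
      rw [if_pos ⟨h, hc⟩, if_pos h, lastExp_succ]
      simp only [Fin.prod_univ_castSucc, sn_castSucc, sn_last]
      have hL : ((lastExp m + 2 * j + 1 : ℕ) : ℂ) ≠ 0 := Nat.cast_ne_zero.2 (Nat.succ_ne_zero _)
      have hA : ∏ i : Fin N, (m i : ℂ) ^ p i ≠ 0 :=
        Finset.prod_ne_zero_iff.2 fun i _ => pow_ne_zero _
          (by exact_mod_cast (h.2 i).2.ne')
      rw [Nat.add_sub_cancel, pow_one, pow_add, pow_mul]
      field_simp
    · rw [if_neg (fun hh => h hh.1), if_neg h, zero_mul]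
  · intro m hm
    rw [Function.mem_support] at hm
    have h : athCond (N + 1) m := by
      by_contra h; exact hm (if_neg h)
    rw [← sn_init m, athCond_sn] at h
    obtain ⟨h1, h2, h3⟩ := h
    have h4 := lastExp_mod h1
    refine ⟨(fun i => m i.castSucc,
      (m (Fin.last N) - lastExp (fun i => m (Fin.castSucc i)) - 1) / 2), ?_⟩
    simp only [hgd]
    conv_rhs => rw [← sn_init m]
    congr 1
    omega

lemma idxCond_sn (k s : ℕ) {N : ℕ} (p : Fin N → ℕ) (a : ℕ) :
    IdxCond k (N + 1) s (sn p a) ↔ (∀ i, 1 ≤ p i) ∧ 1 ≤ a ∧ (∑ i, p i) + a = k ∧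
      (Finset.univ.filter fun i => 2 ≤ p i).card + (if 2 ≤ a then 1 else 0) = s := by
  simp only [IdxCond, Finset.card_filter, Fin.sum_univ_castSucc, sn_castSucc, sn_last,
    Fin.forall_fin_succ', and_assoc]

lemma idxCond0_sn (k s : ℕ) {N : ℕ} (p : Fin N → ℕ) (a : ℕ) :
    IdxCond0 k (N + 1) s (sn p a) ↔ IdxCond k (N + 1) s (sn p a) ∧ 2 ≤ a := by
  unfold IdxCond0
  refine and_congr_right fun _ => ?_
  constructor
  · intro h
    have := h (Nat.succ_pos N)
    change 2 ≤ sn p a (Fin.last N) at this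
    rwa [sn_last] at this
  · intro h _
    change 2 ≤ sn p a (Fin.last N)
    rwa [sn_last]

lemma idx_finite (k n s : ℕ) : {κ | IdxCond k n s κ}.Finite := by
  refine (Fintype.piFinset (fun _ : Fin n => Finset.range (k + 1))).finite_toSet.subset ?_
  intro κ h
  simp only [Finset.mem_coe, Fintype.mem_piFinset, Finset.mem_range]
  intro i
  have := Finset.single_le_sum (f := κ) (fun _ _ => Nat.zero_le _) (Finset.mem_univ i)
  have h2 := h.2.1
  omega

lemma idx0_finite (k n s : ℕ) : {κ | IdxCond0 k n s κ}.Finite :=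
  (idx_finite k n s).subset fun _ h => h.1

lemma fin_tsum {ι : Type*} {P : ι → Prop} (hP : {x | P x}.Finite) (f : ι → ℂ) :
    ∑' i, (if P i then f i else 0) = ∑ i ∈ hP.toFinset, f i := by
  rw [tsum_eq_sum (s := hP.toFinset)]
  · refine Finset.sum_congr rfl fun i hi => ?_
    rw [if_pos (by simpa using hi)]
  · intro i hi
    rw [if_neg (by simpa using hi)]

lemma fin_summable {ι : Type*} {P : ι → Prop} (hP : {x | P x}.Finite) (f : ι → ℂ) :
    Summable fun i => (if P i then f i else 0) := by
  refine summable_of_ne_finset_zero (s := hP.toFinset) ?_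
  intro i hi
  rw [if_neg (by simpa using hi)]

lemma fin_hasDerivAt {ι : Type*} {P : ι → Prop} (hP : {x | P x}.Finite) (f : ι → ℂ → ℂ)
    (f' : ι → ℂ) (t : ℂ) (h : ∀ i, P i → HasDerivAt (f i) (f' i) t) :
    HasDerivAt (fun t => ∑' i, (if P i then f i t else 0)) (∑' i, (if P i then f' i else 0)) t := by
  simp only [fin_tsum hP]
  exact HasDerivAt.fun_sum fun i hi => h i (by simpa using hi)

lemma part1 (k N s : ℕ) (hk : 1 ≤ k) (hs : 1 ≤ s) (t : ℂ) (h0 : t ≠ 0) (ht : ‖t‖ < 1) :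
    HasDerivAt (fun t => G0 k (N + 1) s t)
      (1 / t * (G0 (k - 1) (N + 1) s t + G (k - 1) (N + 1) (s - 1) t
        - G0 (k - 1) (N + 1) (s - 1) t)) t := by
  set dec : (Fin (N + 1) → ℕ) → (Fin (N + 1) → ℕ) := fun κ =>
    sn (fun i => κ i.castSucc) (κ (Fin.last N) - 1) with hdec
  set inc : (Fin (N + 1) → ℕ) → (Fin (N + 1) → ℕ) := fun κ =>
    sn (fun i => κ i.castSucc) (κ (Fin.last N) + 1) with hinc
  have hdi : ∀ κ, dec (inc κ) = κ := by
    intro κ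
    simp only [hdec, hinc, sn_castSucc, sn_last, Nat.add_sub_cancel]
    exact sn_init κ
  have hid : ∀ κ, 1 ≤ κ (Fin.last N) → inc (dec κ) = κ := by
    intro κ h
    simp only [hdec, hinc, sn_castSucc, sn_last, Nat.sub_add_cancel h]
    exact sn_init κ
  have hlast : ∀ κ, IdxCond0 k (N + 1) s κ → 1 ≤ κ (Fin.last N) := fun κ h => h.1.1 _
  have hD := (fin_hasDerivAt (idx0_finite k (N + 1) s) Ath (fun κ => 1 / t * Ath (dec κ) t) t
    (by
      intro κ h
      have := ath_deriv_inc (fun i => κ i.castSucc) (κ (Fin.last N) - 1) h0 ht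
      rw [Nat.sub_add_cancel (hlast κ h), sn_init] at this
      exact this)).const_mul ((2 : ℂ) ^ (N + 1))
  refine hD.congr_deriv ?_
  have hinj : Function.Injective inc := Function.LeftInverse.injective hdi
  rw [← hinj.tsum_eq]
  · unfold G G0
    have e : ∀ a b c d : ℂ, 1 / t * (a * b + a * c - a * d) = a * (1 / t * (b + c - d)) := by
      intros; ring
    rw [e, ← Summable.tsum_add (fin_summable (idx0_finite _ _ _) _)
      (fin_summable (idx_finite _ _ _) _), ← Summable.tsum_sub
      ((fin_summable (idx0_finite _ _ _) _).add (fin_summable (idx_finite _ _ _) _))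
      (fin_summable (idx0_finite _ _ _) _)]
    congr 1
    rw [← tsum_mul_left]
    refine tsum_congr fun κ => ?_
    rw [hdi]
    generalize hA : Ath κ t = A
    have hiff : IdxCond0 k (N + 1) s (inc κ) ↔ IdxCond0 (k - 1) (N + 1) s κ ∨
        (IdxCond (k - 1) (N + 1) (s - 1) κ ∧ ¬ IdxCond0 (k - 1) (N + 1) (s - 1) κ) := by
      rw [← sn_init κ]
      simp only [hinc, sn_castSucc, sn_last, idxCond0_sn, idxCond_sn]
      generalize κ (Fin.last N) = a
      by_cases hp : ∀ i : Fin N, 1 ≤ κ i.castSucc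
      · simp only [hp, implies_true, true_and]
        split_ifs <;> omega
      · simp [hp]
    have hexc : ¬ (IdxCond0 (k - 1) (N + 1) s κ ∧
        (IdxCond (k - 1) (N + 1) (s - 1) κ)) := by
      rintro ⟨h1, h2⟩
      have h3 := h1.1.2.2
      have h4 := h2.2.2
      omega
    have himp : IdxCond0 (k - 1) (N + 1) (s - 1) κ → IdxCond (k - 1) (N + 1) (s - 1) κ :=
      fun h => h.1
    simp only [hiff]
    by_cases h1 : IdxCond0 (k - 1) (N + 1) s κ <;>
    by_cases h2 : IdxCond (k - 1) (N + 1) (s - 1) κ <;>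
    by_cases h3 : IdxCond0 (k - 1) (N + 1) (s - 1) κ <;> simp_all
  · intro κ hκ
    rw [Function.mem_support] at hκ
    have h : IdxCond0 k (N + 1) s κ := by
      by_contra h; exact hκ (if_neg h)
    exact ⟨dec κ, hid κ (hlast κ h)⟩

lemma part2 (k N s : ℕ) (hk : 1 ≤ k) (t : ℂ) (ht : ‖t‖ < 1) :
    HasDerivAt (fun t => G k (N + 1) s t - G0 k (N + 1) s t)
      (2 / (1 - t ^ 2) * G (k - 1) N s t) t := by
  have hG : (fun t => G k (N + 1) s t - G0 k (N + 1) s t) = fun t => (2 : ℂ) ^ (N + 1) *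
      ∑' p : Fin N → ℕ, (if IdxCond (k - 1) N s p then Ath (sn p 1) t else 0) := by
    funext t
    unfold G G0
    rw [← mul_sub, ← Summable.tsum_sub (fin_summable (idx_finite _ _ _) _)
      (fin_summable (idx0_finite _ _ _) _)]
    congr 1
    have hinj : Function.Injective (fun p : Fin N → ℕ => sn p 1) :=
      fun p q h => (sn_inj h).1
    rw [← hinj.tsum_eq]
    · refine tsum_congr fun p => ?_
      have h1 : ¬ IdxCond0 k (N + 1) s (sn p 1) := by
        rw [idxCond0_sn]; omega
      have h2 : IdxCond k (N + 1) s (sn p 1) ↔ IdxCond (k - 1) N s p := by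
        rw [idxCond_sn, IdxCond]
        refine and_congr_right fun _ => ?_
        norm_num
        intro _
        omega
      simp [h1, h2]
    · intro κ hκ
      rw [Function.mem_support] at hκ
      refine ⟨fun i => κ i.castSucc, ?_⟩
      have h1 : κ (Fin.last N) = 1 := by
        by_contra hne
        apply hκ
        have : IdxCond k (N + 1) s κ ↔ IdxCond0 k (N + 1) s κ := by
          rw [← sn_init κ, idxCond0_sn]
          refine ⟨fun h => ⟨h, ?_⟩, fun h => h.1⟩
          have := h.1 (Fin.last N)
          rw [sn_last] at this
          omega
        simp [this]
      conv_rhs => rw [← sn_init κ, h1]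
  rw [hG]
  refine ((fin_hasDerivAt (idx_finite (k - 1) N s) (fun p => Ath (sn p 1))
    (fun p => 1 / (1 - t ^ 2) * Ath p t) t
    (fun p _ => ath_deriv_one p ht)).const_mul ((2 : ℂ) ^ (N + 1))).congr_deriv ?_
  unfold G
  simp only [fin_tsum (idx_finite (k - 1) N s), ← Finset.mul_sum]
  ring

lemma part3 (k s : ℕ) (t : ℂ) : G k 0 s t = if k = 0 ∧ s = 0 then 1 else 0 := by
  have hA : ∀ κ : Fin 0 → ℕ, Ath κ t = 1 := by
    intro κ
    rw [Ath, tsum_eq_single (fun i : Fin 0 => i.elim0)]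
    · have : athCond 0 (fun i : Fin 0 => i.elim0) :=
        ⟨fun i => i.elim0, fun i => i.elim0⟩
      rw [if_pos this, lastExp_zero]
      simp
    · intro m hm
      exact absurd (Subsingleton.elim _ _) hm
  rw [G, tsum_eq_single (fun i : Fin 0 => i.elim0)]
  · have : IdxCond k 0 s (fun i : Fin 0 => i.elim0) ↔ k = 0 ∧ s = 0 := by
      simp [IdxCond, eq_comm]
    simp [this, hA]
  · intro m hm
    exact absurd (Subsingleton.elim _ _) hm

/-- Differentiation rules for `G₀` and `G − G₀`, together with the convention
`G(k,0,s;t) = 1` if `(k,s) = (0,0)` and `0` otherwise. -/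
theorem G_recursions :
    (∀ k n s : ℕ, 1 ≤ k → 1 ≤ n → 1 ≤ s → ∀ t : ℂ, 0 < ‖t‖ → ‖t‖ < 1 →
      HasDerivAt (fun t => G0 k n s t)
        (1 / t * (G0 (k - 1) n s t + G (k - 1) n (s - 1) t - G0 (k - 1) n (s - 1) t)) t) ∧
    (∀ k n s : ℕ, 1 ≤ k → 1 ≤ n → ∀ t : ℂ, ‖t‖ < 1 →
      HasDerivAt (fun t => G k n s t - G0 k n s t)
        (2 / (1 - t ^ 2) * G (k - 1) (n - 1) s t) t) ∧
    (∀ k s : ℕ, ∀ t : ℂ, G k 0 s t = if k = 0 ∧ s = 0 then 1 else 0) := by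
  refine ⟨?_, ?_, part3⟩
  · intro k n s hk hn hs t h0 ht
    obtain ⟨N, rfl⟩ : ∃ N, n = N + 1 := ⟨n - 1, by omega⟩
    exact part1 k N s hk hs t (norm_pos_iff.1 h0) ht
  · intro k n s hk hn t ht
    obtain ⟨N, rfl⟩ : ∃ N, n = N + 1 := ⟨n - 1, by omega⟩
    exact part2 k N s hk t ht

end
end
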